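/- arXiv:1208.3978 — 2 statements merged into one kernel-verified Lean document; each statement's English description precedes it below -/
import Mathlib

section
/- q-binomial theorem for Macdonald polynomials (Lascoux–Warnaar): for all partitions μ, ν and parameters a, b, Σ_λ Q_{λ/ν}((a−b)/(1−t)) P_{λ/μ}(X;q,t) = (Π_{x∈X} (bx;q)_∞/(ax;q)_∞) · Σ_λ Q_{μ/λ}((a−b)/(1−t)) P_{ν/λ}(X;q,t), as an identity of symmetric formal power series in the variables X, where (cx;q)_∞ = Π_{j≥0}(1−cxq^j). -/
/-!
Common framework: integer partitions, Gaussian binomials, Hall--Littlewood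
Pieri coefficients, the ring of symmetric functions realized as polynomials
in the power sums, the Macdonald `(q,t)`-inner product, a characterisation
of the Macdonald polynomials `P_λ(X;q,t)`, skew Macdonald polynomials,
plethystic evaluations and the various Pieri coefficients of
Konvalinka--Lauve and Warnaar.
-/

open scoped BigOperators

noncomputable section

namespace SkewPieriFormalization

/-- An integer partition, encoded as a finitely supported weakly decreasing
sequence of natural numbers; `part j` is the part `λ_{j+1}` (0-indexed). -/
structure Partition where
  part : ℕ →₀ ℕ
  antitone' : ∀ ⦃i j : ℕ⦄, i ≤ j → part j ≤ part i

namespace Partition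

/-- Containment of Young diagrams: `μ ≤ λ` iff `μ_i ≤ λ_i` for all `i`. -/
instance : LE Partition := ⟨fun mu lam => ∀ j : ℕ, mu.part j ≤ lam.part j⟩

/-- `|λ|`, the size (sum of the parts). -/
def size (lam : Partition) : ℕ := lam.part.sum fun _ k => k

/-- `l(λ)`, the number of (nonzero) parts. -/
def length (lam : Partition) : ℕ := lam.part.support.card

/-- `n(λ) = ∑_{i ≥ 1} (i-1) λ_i`. -/
def nstat (lam : Partition) : ℕ := lam.part.sum fun j k => j * k

/-- the `i`-th part `λ_i` (1-indexed). -/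
def row (lam : Partition) (i : ℕ) : ℕ := lam.part (i - 1)

/-- the part `λ'_i = #{j : λ_j ≥ i}` of the conjugate partition (for `i ≥ 1`). -/
def conj (lam : Partition) (i : ℕ) : ℕ :=
  (lam.part.support.filter fun j => i ≤ lam.part j).card

/-- the multiplicity `m_r(λ)` of `r` as a part of `λ`. -/
def mult (lam : Partition) (r : ℕ) : ℕ :=
  (lam.part.support.filter fun j => lam.part j = r).card

/-- `z_λ = ∏_{r ≥ 1} r^{m_r} m_r!`. -/
def zee (lam : Partition) : ℕ :=
  ∏ r ∈ Finset.Icc 1 (lam.part 0), r ^ lam.mult r * Nat.factorial (lam.mult r)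

/-- the partial sum `λ_1 + ⋯ + λ_k`. -/
def psum (lam : Partition) (k : ℕ) : ℕ := ∑ j ∈ Finset.range k, lam.part j

/-- dominance order: `λ ⊵ μ` (for `|λ| = |μ|`). -/
def Dominates (lam mu : Partition) : Prop :=
  mu.size = lam.size ∧ ∀ k : ℕ, mu.psum k ≤ lam.psum k

/-- the one-row partition `(r)`. -/
def single (r : ℕ) : Partition where
  part := Finsupp.single 0 r
  antitone' := by
    intro i j hij
    by_cases hj : j = 0
    · have : i = 0 := by omega
      simp [hj, this]
    · simp only [Finsupp.single_apply]
      split <;> split <;> omega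

/-- the one-column partition `(1^m)`. -/
def column (m : ℕ) : Partition where
  part := Finsupp.onFinset (Finset.range m) (fun j => if j < m then 1 else 0)
    (fun j h => by
      simp only [Finset.mem_range]
      by_contra hc
      simp [hc] at h)
  antitone' := by
    intro i j hij
    simp only [Finsupp.onFinset_apply]
    split <;> split <;> omega

end Partition

variable {F : Type*} [Field F]

/-- the `t`-integer `[n]_t = 1 + t + ⋯ + t^{n-1}`. -/
def qint (t : F) (n : ℕ) : F := ∑ j ∈ Finset.range n, t ^ j

/-- the `t`-factorial. -/
def qfac (t : F) (n : ℕ) : F := ∏ j ∈ Finset.range n, qint t (j + 1)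

/-- the Gaussian binomial coefficient `[n choose k]_t`; it vanishes
unless `0 ≤ k ≤ n`. -/
def qbinom (t : F) (n k : ℤ) : F :=
  if 0 ≤ k ∧ k ≤ n then qfac t n.toNat / (qfac t k.toNat * qfac t (n - k).toNat) else 0

/-- the Hall--Littlewood Pieri coefficient
`ψ'_{λ/μ}(t) = ∏_{i ≥ 1} [λ'_i - λ'_{i+1} choose λ'_i - μ'_i]_t`;
it vanishes unless `μ ⊆ λ` with `λ - μ` a vertical strip. -/
def vsHL (t : F) (lam mu : Partition) : F :=
  ∏ i ∈ Finset.Icc 1 (lam.part 0 + mu.part 0),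
    qbinom t ((lam.conj i : ℤ) - lam.conj (i + 1)) ((lam.conj i : ℤ) - mu.conj i)

open Classical in
/-- the Hall--Littlewood Pieri coefficient `φ_{λ/μ}(t)`, equal to
`∏ (1 - t^{λ'_i - λ'_{i+1}})` over those `i ≥ 1` with `λ'_i = μ'_i + 1` and
`λ'_{i+1} = μ'_{i+1}`, when `μ ⊆ λ` with `λ - μ` a horizontal strip, and
vanishing otherwise. -/
def hsHL (t : F) (lam mu : Partition) : F :=
  if ∀ i : ℕ, mu.conj i ≤ lam.conj i ∧ lam.conj i ≤ mu.conj i + 1 then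
    ∏ i ∈ Finset.Icc 1 (lam.part 0 + mu.part 0),
      if lam.conj i = mu.conj i + 1 ∧ lam.conj (i + 1) = mu.conj (i + 1) then
        1 - t ^ (lam.conj i - lam.conj (i + 1))
      else 1
  else 0

/-- `n(λ/μ) = ∑_{i ≥ 1} C(λ'_i - μ'_i, 2)`. -/
def nskew (lam mu : Partition) : ℕ :=
  ∑ i ∈ Finset.Icc 1 (lam.part 0 + mu.part 0), Nat.choose (lam.conj i - mu.conj i) 2

/-- the Konvalinka--Lauve coefficient
`sk_{λ/μ}(t) = t^{n(λ/μ)} ∏_{i ≥ 1} [λ'_i - μ'_{i+1} choose λ'_i - μ'_i]_t`;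
it vanishes unless `μ ⊆ λ`. -/
def skHL (t : F) (lam mu : Partition) : F :=
  t ^ nskew lam mu *
    ∏ i ∈ Finset.Icc 1 (lam.part 0 + mu.part 0),
      qbinom t ((lam.conj i : ℤ) - mu.conj (i + 1)) ((lam.conj i : ℤ) - mu.conj i)

/-- The ring of symmetric functions over `F`, realized as the polynomial ring
in the power sums: the variable `n` is the power sum `p_{n+1}`. -/
abbrev Sym (F : Type*) [Field F] := MvPolynomial ℕ F

/-- the power sum product `p_λ = p_{λ_1} p_{λ_2} ⋯`. -/
def pprod (lam : Partition) : Sym F :=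
  ∏ j ∈ lam.part.support, MvPolynomial.X (lam.part j - 1)

/-- Macdonald's `(q,t)`-deformation of the Hall inner product, for which the
power sums are orthogonal with `⟨p_λ, p_λ⟩ = z_λ ∏_i (1-q^{λ_i})/(1-t^{λ_i})`. -/
def innerQT (q t : F) (f g : Sym F) : F :=
  ∑ d ∈ f.support,
    f.coeff d * g.coeff d *
      d.prod fun n m =>
        (((n : F) + 1) ^ m * (Nat.factorial m : F)) *
          ((1 - q ^ (n + 1)) / (1 - t ^ (n + 1))) ^ m

/-- the complete homogeneous symmetric function `h_r = ∑_{|κ| = r} z_κ⁻¹ p_κ`. -/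
def hsym (F : Type*) [Field F] (r : ℕ) : Sym F :=
  ∑ᶠ (k : Partition) (_ : k.size = r), ((k.zee : F))⁻¹ • (pprod k : Sym F)

/-- the elementary symmetric function `e_r = ∑_{|κ| = r} (-1)^{r - l(κ)} z_κ⁻¹ p_κ`. -/
def esym (F : Type*) [Field F] (r : ℕ) : Sym F :=
  ∑ᶠ (k : Partition) (_ : k.size = r),
    ((-1 : F) ^ (r - k.length) * (k.zee : F)⁻¹) • (pprod k : Sym F)

/-- `h_μ = h_{μ_1} h_{μ_2} ⋯`. -/
def hprod (F : Type*) [Field F] (mu : Partition) : Sym F :=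
  ∏ j ∈ mu.part.support, hsym F (mu.part j)

/-- Characterisation of the (monic) Macdonald polynomial family
`λ ↦ P_λ(X;q,t)`: the `P_λ` are pairwise orthogonal for the `(q,t)`-inner
product, and `P_λ = m_λ + ∑_{μ ⊲ λ} u_{λμ} m_μ` is unitriangular with respect
to dominance order in the monomial basis.  Since `{h_μ}` is the dual basis of
`{m_μ}` for the classical Hall pairing (the case `q = t`), unitriangularity is
expressed by the last two conditions.  For `q = 0` this characterises the
Hall--Littlewood polynomials `P_λ(X;t)`. -/
def IsMacdonald (q t : F) (P : Partition → Sym F) : Prop :=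
  (∀ lam mu, lam ≠ mu → innerQT q t (P lam) (P mu) = 0) ∧
  (∀ lam, innerQT t t (P lam) (hprod F lam) = 1) ∧
  (∀ lam mu, ¬ Partition.Dominates lam mu → innerQT t t (P lam) (hprod F mu) = 0)

/-- `b_λ = ⟨P_λ, P_λ⟩⁻¹`. -/
def bnorm (q t : F) (P : Partition → Sym F) (lam : Partition) : F :=
  (innerQT q t (P lam) (P lam))⁻¹

/-- `Q_λ = b_λ P_λ`. -/
def macQ (q t : F) (P : Partition → Sym F) (lam : Partition) : Sym F :=
  bnorm q t P lam • P lam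

/-- the skew Macdonald polynomial `Q_{λ/μ}`, defined by
`⟨Q_{λ/μ}, P_ν⟩ = ⟨Q_λ, P_μ P_ν⟩`. -/
def skewQ (q t : F) (P : Partition → Sym F) (lam mu : Partition) : Sym F :=
  ∑ᶠ nu : Partition, innerQT q t (macQ q t P lam) (P mu * P nu) • macQ q t P nu

/-- the skew Macdonald polynomial `P_{λ/μ}`, defined by
`⟨P_{λ/μ}, Q_ν⟩ = ⟨P_λ, Q_μ Q_ν⟩`. -/
def skewP (q t : F) (P : Partition → Sym F) (lam mu : Partition) : Sym F :=
  ∑ᶠ nu : Partition, innerQT q t (P lam) (macQ q t P mu * macQ q t P nu) • P nu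

/-- the Littlewood--Richardson coefficient `f_{μν}^λ(q,t) = ⟨Q_λ, P_μ P_ν⟩`,
so that `P_μ P_ν = ∑_λ f_{μν}^λ P_λ`. -/
def lr (q t : F) (P : Partition → Sym F) (mu nu lam : Partition) : F :=
  innerQT q t (macQ q t P lam) (P mu * P nu)

/-- the plethystic evaluation `f ↦ f((a-b)/(1-t))`, determined on power sums
by `p_r ↦ (a^r - b^r)/(1 - t^r)`. -/
def plethAB (t a b : F) (f : Sym F) : F :=
  MvPolynomial.eval (fun n => (a ^ (n + 1) - b ^ (n + 1)) / (1 - t ^ (n + 1))) f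

/-- `vs_{λ/μ}(q,t) = ψ'_{λ/μ}(q,t) = (-1)^{|λ|-|μ|} Q_{λ/μ}((q-1)/(1-t))`. -/
def vsM (q t : F) (P : Partition → Sym F) (lam mu : Partition) : F :=
  (-1 : F) ^ ((lam.size : ℤ) - (mu.size : ℤ)) * plethAB t q 1 (skewQ q t P lam mu)

/-- `sk_{λ/μ}(q,t) = Q_{λ/μ}((1-q)/(1-t))`. -/
def skM (q t : F) (P : Partition → Sym F) (lam mu : Partition) : F :=
  plethAB t 1 q (skewQ q t P lam mu)

/-- `ŝk_{λ/μ}(q,t) = Q_{λ/μ}((1-q/t)/(1-t))`. -/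
def skHatM (q t : F) (P : Partition → Sym F) (lam mu : Partition) : F :=
  plethAB t 1 (q / t) (skewQ q t P lam mu)

/-- `hs_{λ/μ}(q,t) = φ_{λ/μ}(q,t) = Q_{λ/μ}(1)`, the plethystic evaluation
`p_r ↦ 1`. -/
def hsM (q t : F) (P : Partition → Sym F) (lam mu : Partition) : F :=
  MvPolynomial.eval (fun _ => (1 : F)) (skewQ q t P lam mu)

/-- `ks_{λ/μ}(q,t) = Q_{λ/μ}(-1)`, the plethystic evaluation `p_r ↦ -1`. -/
def ksM (q t : F) (P : Partition → Sym F) (lam mu : Partition) : F :=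
  MvPolynomial.eval (fun _ => (-1 : F)) (skewQ q t P lam mu)

/-- the finite `q`-Pochhammer symbol `(a;q)_k = ∏_{j=0}^{k-1}(1 - a q^j)`. -/
def qPochN (qq a : F) (k : ℕ) : F := ∏ j ∈ Finset.range k, (1 - a * qq ^ j)

/-- the `q`-Pochhammer symbol `(a;q)_k = (a;q)_∞/(a q^k;q)_∞` for `k ∈ ℤ`;
for `k = -m < 0` it equals `1/∏_{i=1}^m (1 - a q^{-i})`. -/
def qPochZ (qq a : F) (k : ℤ) : F :=
  if 0 ≤ k then qPochN qq a k.toNat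
  else (∏ j ∈ Finset.range (-k).toNat, (1 - a * (qq⁻¹) ^ (j + 1)))⁻¹

/-- `(a)_λ = (a;q,t)_λ = ∏_{i ≥ 1} (a t^{1-i}; q)_{λ_i}`. -/
def qtPoch (qq tt a : F) (lam : Partition) : F :=
  ∏ j ∈ lam.part.support, qPochN qq (a * tt ^ (-(j : ℤ))) (lam.part j)

/-- the degree (as a symmetric function) of a power-sum exponent vector. -/
def wt (d : ℕ →₀ ℕ) : ℕ := d.sum fun n m => (n + 1) * m

/-- the degree-`r` homogeneous component of `∏_x (bx;q)_∞/(ax;q)_∞`, namely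
`∑_{|κ| = r} z_κ⁻¹ ∏_i (a^{κ_i} - b^{κ_i})/(1 - q^{κ_i}) · p_κ`. -/
def prodComp (a b qq : F) (r : ℕ) : Sym F :=
  ∑ᶠ (k : Partition) (_ : k.size = r),
    ((k.zee : F)⁻¹ *
        ∏ j ∈ k.part.support,
          (a ^ k.part j - b ^ k.part j) / (1 - qq ^ k.part j)) • (pprod k : Sym F)

/-- `∏_x (bx;q)_∞/(ax;q)_∞`, where `(cx;q)_∞ = ∏_{j ≥ 0}(1 - cx q^j)`, as a
formal power series in the power sums. -/
def prodSeries (a b qq : F) : MvPowerSeries ℕ F :=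
  fun d => MvPolynomial.coeff d (prodComp a b qq (wt d))

/-- the formal (possibly infinite) sum `∑_i c_i g_i` of symmetric functions,
as a formal power series in the power sums. -/
def sumSeries {ι : Type*} (c : ι → F) (g : ι → Sym F) : MvPowerSeries ℕ F :=
  fun d => ∑ᶠ i : ι, c i * MvPolynomial.coeff d (g i)

/-- `ℚ(t)` -/
abbrev F1 : Type := RatFunc ℚ
/-- `ℚ(t)(q)` -/
abbrev F2 : Type := RatFunc F1
/-- `ℚ(t)(q)(a)` -/
abbrev F3 : Type := RatFunc F2
/-- `ℚ(t)(q)(a)(b)` -/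
abbrev F4 : Type := RatFunc F3

instance : Field F2 := inferInstance
instance : Field F3 := inferInstance
instance : Field F4 := inferInstance

/-- the indeterminate `t` in `ℚ(t)`. -/
def t1 : F1 := RatFunc.X
/-- the indeterminate `q` in `ℚ(t)(q)`. -/
def q2 : F2 := RatFunc.X
/-- the indeterminate `t` in `ℚ(t)(q)`. -/
def t2 : F2 := RatFunc.C t1
/-- the indeterminate `a` in `ℚ(t)(q)(a)`. -/
def a3 : F3 := RatFunc.X
/-- the indeterminate `q` in `ℚ(t)(q)(a)`. -/
def q3 : F3 := RatFunc.C q2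
/-- the indeterminate `t` in `ℚ(t)(q)(a)`. -/
def t3 : F3 := RatFunc.C t2
/-- the indeterminate `b` in `ℚ(t)(q)(a)(b)`. -/
def b4 : F4 := RatFunc.X
/-- the indeterminate `a` in `ℚ(t)(q)(a)(b)`. -/
def a4 : F4 := RatFunc.C a3
/-- the indeterminate `q` in `ℚ(t)(q)(a)(b)`. -/
def q4 : F4 := RatFunc.C q3
/-- the indeterminate `t` in `ℚ(t)(q)(a)(b)`. -/
def t4 : F4 := RatFunc.C t3


/-! ### Partitions and exponent vectors -/

/-- exponent vector of `p_λ`. -/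
def expo (k : Partition) : ℕ →₀ ℕ :=
  ∑ j ∈ k.part.support, Finsupp.single (k.part j - 1) 1

theorem expo_prod {M : Type*} [CommMonoid M] (k : Partition) (f : ℕ → M) :
    ((expo k).prod fun n m => f (n + 1) ^ m) = ∏ j ∈ k.part.support, f (k.part j) := by
  unfold expo
  rw [← Finsupp.prod_finsetSum_index (by simp) (by intros; rw [pow_add])]
  refine Finset.prod_congr rfl fun j hj => ?_
  rw [Finsupp.prod_single_index (by simp), pow_one]
  have : k.part j ≠ 0 := Finsupp.mem_support_iff.mp hj
  congr 1; omega

theorem expo_sum {M : Type*} [AddCommMonoid M] (k : Partition) (f : ℕ → M) :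
    ((expo k).sum fun n m => m • f (n + 1)) = ∑ j ∈ k.part.support, f (k.part j) := by
  unfold expo
  rw [← Finsupp.sum_finsetSum_index (by simp) (by intros; rw [add_nsmul])]
  refine Finset.sum_congr rfl fun j hj => ?_
  rw [Finsupp.sum_single_index (by simp), one_nsmul]
  have : k.part j ≠ 0 := Finsupp.mem_support_iff.mp hj
  congr 1; omega

theorem lower_eq_range (s : Finset ℕ) (h : ∀ i j, i ≤ j → j ∈ s → i ∈ s) :
    s = Finset.range s.card := by
  ext j
  rw [Finset.mem_range]
  constructor
  · intro hj
    have : Finset.range (j + 1) ⊆ s := fun i hi => h i j (by simp at hi; omega) hj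
    have := Finset.card_le_card this
    simp at this; omega
  · intro hj
    by_contra hc
    have : s ⊆ Finset.range j := by
      intro i hi
      rw [Finset.mem_range]
      by_contra hij
      exact hc (h j i (by omega) hi)
    have := Finset.card_le_card this
    simp at this; omega

theorem le_part_iff (k : Partition) (i : ℕ) (hi : 1 ≤ i) (j : ℕ) :
    i ≤ k.part j ↔ j < k.conj i := by
  have h := lower_eq_range (k.part.support.filter fun j => i ≤ k.part j) (by
    intro a b hab hb
    simp only [Finset.mem_filter, Finsupp.mem_support_iff] at hb ⊢
    have := k.antitone' hab
    omega)
  have h2 : j ∈ (k.part.support.filter fun j => i ≤ k.part j) ↔ j < k.conj i := by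
    rw [h, Finset.mem_range]; rfl
  rw [← h2]
  simp only [Finset.mem_filter, Finsupp.mem_support_iff]
  omega

theorem conj_eq_expo (k : Partition) (i : ℕ) :
    k.conj i = (expo k).sum fun n m => m • (if i ≤ n + 1 then 1 else 0) := by
  rw [expo_sum k (fun r => if i ≤ r then 1 else 0)]
  simp [Partition.conj]

theorem part_ext {k l : Partition} (h : ∀ j, k.part j = l.part j) : k = l := by
  cases k; cases l
  congr
  exact Finsupp.ext h

theorem expo_injective : Function.Injective expo := by
  intro k l h
  apply part_ext
  intro j
  have key : ∀ i, 1 ≤ i → (i ≤ k.part j ↔ i ≤ l.part j) := by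
    intro i hi
    rw [le_part_iff k i hi, le_part_iff l i hi, conj_eq_expo, conj_eq_expo, h]
  have h1 := key (k.part j)
  have h2 := key (l.part j)
  omega

theorem list_sum_single (L : List ℕ) :
    (L.map fun x => Finsupp.single x 1).sum = Multiset.toFinsupp (L : Multiset ℕ) := by
  induction L with
  | nil => simp
  | cons a L ih =>
    rw [List.map_cons, List.sum_cons, ih, ← Multiset.cons_coe, ← Multiset.singleton_add, map_add,
      Multiset.toFinsupp_singleton]

theorem expo_surjective : Function.Surjective expo := by
  intro d
  set L := (Finsupp.toMultiset d).sort (fun a b => b ≤ a) with hL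
  have hs : L.Pairwise (fun a b => b ≤ a) := Multiset.pairwise_sort _ _
  let f : ℕ → ℕ := fun j => if h : j < L.length then L[j] + 1 else 0
  have hf : ∀ j, f j ≠ 0 → j ∈ Finset.range L.length := by
    intro j hj
    by_contra hc
    simp only [Finset.mem_range] at hc
    simp [f, hc] at hj
  let k : Partition := ⟨Finsupp.onFinset (Finset.range L.length) f hf, by
    intro i j hij
    simp only [Finsupp.onFinset_apply, f]
    split_ifs with h1 h2
    · rcases hij.lt_or_eq with h | h
      · have := List.pairwise_iff_getElem.mp hs i j h2 h1 h
        omega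
      · subst h; rfl
    · omega
    · omega
    · omega⟩
  refine ⟨k, ?_⟩
  have hsupp : k.part.support = Finset.range L.length := by
    ext j
    simp [k, f]
  unfold expo
  rw [hsupp, Finset.sum_range]
  have : ∀ i : Fin L.length, Finsupp.single (k.part i - 1) 1 = (fun x => Finsupp.single x 1) L[i] := by
    intro i
    simp [k, f]
  simp only [this]
  have e := Fin.sum_univ_fun_getElem L (fun x => (Finsupp.single x 1 : ℕ →₀ ℕ))
  simp only [Fin.getElem_fin]
  rw [e, list_sum_single, hL, Multiset.sort_eq, Finsupp.toMultiset_toFinsupp]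

/-- partitions are exponent vectors -/
def expoEquiv : Partition ≃ (ℕ →₀ ℕ) :=
  Equiv.ofBijective expo ⟨expo_injective, expo_surjective⟩

@[simp] theorem expoEquiv_apply (k : Partition) : expoEquiv k = expo k := rfl

theorem expo_symm (d : ℕ →₀ ℕ) : expo (expoEquiv.symm d) = d := expoEquiv.apply_symm_apply d

theorem wt_expo (k : Partition) : wt (expo k) = k.size := by
  have := expo_sum k (fun r => r)
  simp only [wt, Partition.size, Finsupp.sum] at *
  rw [← this]
  refine Finset.sum_congr rfl fun n _ => ?_
  simp [mul_comm]

theorem expo_apply (k : Partition) (n : ℕ) : expo k n = k.mult (n + 1) := by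
  simp only [expo, Partition.mult, Finsupp.finsetSum_apply, Finsupp.single_apply,
    Finset.card_filter]
  refine Finset.sum_congr rfl fun j hj => ?_
  have : k.part j ≠ 0 := Finsupp.mem_support_iff.mp hj
  congr 1
  simp only [eq_iff_iff]; omega

/-- `z` on exponent vectors -/
def zexp (d : ℕ →₀ ℕ) : ℕ := d.prod fun n m => (n + 1) ^ m * Nat.factorial m

theorem zee_expo (k : Partition) : k.zee = zexp (expo k) := by
  unfold zexp Partition.zee
  rw [Finsupp.prod_of_support_subset (s := Finset.range (k.part 0))]
  · have e : Finset.Icc 1 (k.part 0) = (Finset.range (k.part 0)).image (fun n => n + 1) := by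
      ext r
      simp only [Finset.mem_Icc, Finset.mem_image, Finset.mem_range]
      constructor
      · rintro ⟨h1, h2⟩
        exact ⟨r - 1, by omega, by omega⟩
      · rintro ⟨n, h1, rfl⟩
        omega
    rw [e, Finset.prod_image (by intro a _ b _ h; simpa using h)]
    refine Finset.prod_congr rfl fun n _ => ?_
    rw [expo_apply]
  · intro n hn
    rw [Finsupp.mem_support_iff, expo_apply, Partition.mult, Finset.card_ne_zero] at hn
    obtain ⟨j, hj⟩ := hn
    rw [Finset.mem_filter] at hj
    have := k.antitone' (Nat.zero_le j)
    rw [Finset.mem_range]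
    omega
  · simp

theorem pprod_expo {F : Type*} [Field F] (k : Partition) :
    (pprod k : Sym F) = MvPolynomial.monomial (expo k) 1 := by
  rw [pprod, MvPolynomial.monomial_eq, MvPolynomial.C_1, one_mul]
  exact (expo_prod k (fun r => (MvPolynomial.X (r - 1) : Sym F))).symm

theorem wt_add (d e : ℕ →₀ ℕ) : wt (d + e) = wt d + wt e :=
  Finsupp.sum_add_index' (by simp) (by intros; ring)

theorem wt_finite (r : ℕ) : {d : ℕ →₀ ℕ | wt d = r}.Finite := by
  refine (Set.finite_Iic (∑ n ∈ Finset.range r, Finsupp.single n r)).subset ?_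
  intro d hd n
  rw [Finsupp.finsetSum_apply]
  simp only [Finsupp.single_apply, Finset.sum_ite_eq', Finset.mem_range]
  by_cases h : d n = 0
  · rw [h]; exact Nat.zero_le _
  have h2 : (n + 1) * d n ≤ r := by
    rw [← (show wt d = r from hd)]
    exact Finset.single_le_sum (f := fun n => (n + 1) * d n) (by simp)
      (Finsupp.mem_support_iff.mpr h)
  have h3 : 1 ≤ d n := by omega
  split_ifs with h4
  · nlinarith
  · nlinarith

theorem size_finite (r : ℕ) : {k : Partition | k.size = r}.Finite := by
  have : {k : Partition | k.size = r} = expo ⁻¹' {d | wt d = r} := by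
    ext k; simp [wt_expo]
  rw [this]
  exact (wt_finite r).preimage expo_injective.injOn

theorem coeff_finsum {F : Type*} [Field F] (c : Partition → F) (r : ℕ) (d : ℕ →₀ ℕ) :
    MvPolynomial.coeff d (∑ᶠ (k : Partition) (_ : k.size = r), c k • (pprod k : Sym F)) =
      if wt d = r then c (expoEquiv.symm d) else 0 := by
  have e := finsum_mem_eq_finite_toFinset_sum (fun k => c k • (pprod k : Sym F)) (size_finite r)
  simp only [Set.mem_ofPred_eq] at e
  rw [e, MvPolynomial.coeff_sum]
  simp only [pprod_expo, MvPolynomial.coeff_smul, MvPolynomial.coeff_monomial, smul_eq_mul,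
    mul_ite, mul_one, mul_zero]
  have hd : ∀ k : Partition, expo k = d ↔ k = expoEquiv.symm d := by
    intro k
    rw [Equiv.eq_symm_apply]; rfl
  have hw : wt d = (expoEquiv.symm d).size := by rw [← wt_expo, expo_symm]
  split_ifs with h
  · rw [Finset.sum_eq_single (expoEquiv.symm d)]
    · rw [if_pos (expo_symm d)]
    · intro k _ hk
      rw [if_neg (by rw [hd]; exact hk)]
    · intro hn
      exact absurd ((size_finite r).mem_toFinset.mpr (hw.symm.trans h)) hn
  · refine Finset.sum_eq_zero fun k hk => ?_
    rw [if_neg]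
    intro hkd
    apply h
    rw [← hkd, wt_expo]
    exact (size_finite r).mem_toFinset.mp hk

/-! ### The pairing between power series and polynomials -/

theorem prod_succ {M : Type*} [CommMonoid M] (h : ℕ → ℕ → M) (h0 : ∀ n, h n 0 = 1)
    (d : ℕ →₀ ℕ) (n : ℕ) (c : M) (hc : h n (d n + 1) = c * h n (d n)) :
    (d + Finsupp.single n 1).prod h = c * d.prod h := by
  classical
  rw [Finsupp.prod_of_support_subset (s := insert n d.support) _ _ _ (fun i _ => h0 i),
    Finsupp.prod_of_support_subset (s := insert n d.support) _ (Finset.subset_insert _ _) _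
      (fun i _ => h0 i),
    ← Finset.mul_prod_erase _ _ (Finset.mem_insert_self n _),
    ← Finset.mul_prod_erase (insert n d.support) (fun x => h x (d x))
      (Finset.mem_insert_self n _)]
  · simp only [Finsupp.add_apply, Finsupp.single_eq_same]
    rw [hc, mul_assoc]
    congr 2
    refine Finset.prod_congr rfl fun i hi => ?_
    rw [Finsupp.single_eq_of_ne (Finset.ne_of_mem_erase hi), add_zero]
  · intro i hi
    rw [Finsupp.mem_support_iff, Finsupp.add_apply] at hi
    rw [Finset.mem_insert, Finsupp.mem_support_iff]
    by_contra hcon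
    push Not at hcon
    rw [Finsupp.single_eq_of_ne hcon.1, hcon.2] at hi
    exact hi rfl

section pairing

variable {F : Type*} [Field F]

/-- the weight `⟨p^d, p^d⟩`. -/
def W (q t : F) (d : ℕ →₀ ℕ) : F :=
  d.prod fun n m => (((n : F) + 1) ^ m * (Nat.factorial m : F)) *
          ((1 - q ^ (n + 1)) / (1 - t ^ (n + 1))) ^ m

/-- the weight of one power sum -/
def w1 (q t : F) (n : ℕ) : F := ((n : F) + 1) * ((1 - q ^ (n + 1)) / (1 - t ^ (n + 1)))

theorem W_zero (q t : F) : W q t 0 = 1 := by simp [W]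

theorem W_succ (q t : F) (d : ℕ →₀ ℕ) (n : ℕ) :
    W q t (d + Finsupp.single n 1) = w1 q t n * ((d n : F) + 1) * W q t d := by
  unfold W
  apply prod_succ
  · simp
  · rw [Nat.factorial_succ, w1]
    push_cast
    ring

theorem W_ne_zero [CharZero F] (q t : F) (hq : ∀ n : ℕ, 1 - q ^ (n + 1) ≠ 0)
    (ht : ∀ n : ℕ, 1 - t ^ (n + 1) ≠ 0) (d : ℕ →₀ ℕ) : W q t d ≠ 0 := by
  unfold W Finsupp.prod
  rw [Finset.prod_ne_zero_iff]
  intro n _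
  have h1 : ((n : F) + 1) ≠ 0 := by exact_mod_cast Nat.succ_ne_zero n
  have h2 : ((Nat.factorial (d n) : ℕ) : F) ≠ 0 := by exact_mod_cast Nat.factorial_ne_zero _
  exact mul_ne_zero (mul_ne_zero (pow_ne_zero _ h1) h2) (pow_ne_zero _ (div_ne_zero (hq n) (ht n)))

/-- pairing of a power series with a polynomial -/
def B (q t : F) (G : MvPowerSeries ℕ F) : Sym F →ₗ[F] F :=
  (MvPolynomial.basisMonomials ℕ F).constr F fun d => MvPowerSeries.coeff d G * W q t d

theorem B_monomial (q t : F) (G : MvPowerSeries ℕ F) (d : ℕ →₀ ℕ) (c : F) :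
    B q t G (MvPolynomial.monomial d c) = c * (MvPowerSeries.coeff d G * W q t d) := by
  have h := (MvPolynomial.basisMonomials ℕ F).constr_basis F
    (fun d => MvPowerSeries.coeff d G * W q t d) d
  rw [MvPolynomial.coe_basisMonomials] at h
  have e : MvPolynomial.monomial d c = c • MvPolynomial.monomial d (1 : F) := by
    rw [MvPolynomial.smul_monomial, smul_eq_mul, mul_one]
  rw [e, map_smul, smul_eq_mul, B, h]

theorem B_eq (q t : F) (G : MvPowerSeries ℕ F) (g : Sym F) :
    B q t G g = ∑ d ∈ g.support, g.coeff d * (MvPowerSeries.coeff d G * W q t d) := by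
  conv_lhs => rw [g.as_sum, map_sum]
  simp only [B_monomial]

theorem B_congr (q t : F) (G H : MvPowerSeries ℕ F) (g : Sym F)
    (h : ∀ d ∈ g.support, MvPowerSeries.coeff d G = MvPowerSeries.coeff d H) :
    B q t G g = B q t H g := by
  rw [B_eq, B_eq]
  exact Finset.sum_congr rfl fun d hd => by rw [h d hd]

theorem B_add_left (q t : F) (G H : MvPowerSeries ℕ F) (g : Sym F) :
    B q t (G + H) g = B q t G g + B q t H g := by
  simp only [B_eq, ← Finset.sum_add_distrib, map_add]
  exact Finset.sum_congr rfl fun d hd => by ring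

theorem B_smul_left (q t : F) (c : F) (G : MvPowerSeries ℕ F) (g : Sym F) :
    B q t (c • G) g = c * B q t G g := by
  simp only [B_eq, Finset.mul_sum, map_smul, smul_eq_mul]
  exact Finset.sum_congr rfl fun d hd => by ring

theorem inner_eq_B (q t : F) (f g : Sym F) :
    innerQT q t f g = B q t (f : MvPowerSeries ℕ F) g := by
  classical
  rw [B_eq, innerQT]
  simp only [MvPolynomial.coeff_coe]
  rw [Finset.sum_subset (Finset.subset_union_left (s₂ := g.support)),
    Finset.sum_subset (s₁ := g.support) (Finset.subset_union_right (s₁ := f.support))]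
  · exact Finset.sum_congr rfl fun d hd => by rw [W]; ring
  · intro d _ hd
    rw [MvPolynomial.notMem_support_iff.mp hd]; ring
  · intro d _ hd
    rw [MvPolynomial.notMem_support_iff.mp hd]; ring

theorem inner_comm (q t : F) (f g : Sym F) : innerQT q t f g = innerQT q t g f := by
  classical
  simp only [innerQT]
  rw [Finset.sum_subset (Finset.subset_union_left (s₂ := g.support)),
    Finset.sum_subset (s₁ := g.support) (Finset.subset_union_right (s₁ := f.support))]
  · exact Finset.sum_congr rfl fun d hd => by ring
  · intro d _ hd
    rw [MvPolynomial.notMem_support_iff.mp hd]; ring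
  · intro d _ hd
    rw [MvPolynomial.notMem_support_iff.mp hd]; ring

theorem inner_mul_left (q t : F) (f g h : Sym F) :
    innerQT q t f (g * h) = B q t (f : MvPowerSeries ℕ F) (g * h) := inner_eq_B _ _ _ _

theorem B_mul_X (q t : F) (G : MvPowerSeries ℕ F) (g : Sym F) (n : ℕ) :
    B q t G (g * MvPolynomial.X n) = w1 q t n * B q t (MvPowerSeries.pderiv F n G) g := by
  induction g using MvPolynomial.induction_on' with
  | monomial d c =>
    rw [MvPolynomial.X, MvPolynomial.monomial_mul, B_monomial, B_monomial, W_succ,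
      MvPowerSeries.coeff_pderiv]
    ring
  | add f g hf hg => rw [add_mul, map_add, hf, hg, map_add]; ring

/-- the coefficient of `p_{n+1}` in the logarithm of the product. -/
def c1 (a b q : F) (n : ℕ) : F :=
  (a ^ (n + 1) - b ^ (n + 1)) / (1 - q ^ (n + 1)) / ((n : F) + 1)

theorem coeff_prodSeries (a b q : F) (d : ℕ →₀ ℕ) :
    MvPowerSeries.coeff d (prodSeries a b q) = (zexp d : F)⁻¹ *
      d.prod fun n m => ((a ^ (n + 1) - b ^ (n + 1)) / (1 - q ^ (n + 1))) ^ m := by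
  change MvPolynomial.coeff d (prodComp a b q (wt d)) = _
  rw [prodComp, coeff_finsum, if_pos rfl,
    ← expo_prod _ (fun r => (a ^ r - b ^ r) / (1 - q ^ r)), zee_expo, expo_symm]

theorem zexp_succ (d : ℕ →₀ ℕ) (n : ℕ) :
    zexp (d + Finsupp.single n 1) = (n + 1) * (d n + 1) * zexp d := by
  unfold zexp
  apply prod_succ
  · simp
  · rw [Nat.factorial_succ]
    ring

theorem pderiv_prodSeries [CharZero F] (a b q : F) (n : ℕ) :
    MvPowerSeries.pderiv F n (prodSeries a b q) = c1 a b q n • prodSeries a b q := by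
  ext d
  rw [MvPowerSeries.coeff_pderiv, map_smul, smul_eq_mul, coeff_prodSeries, coeff_prodSeries,
    zexp_succ, prod_succ (n := n) (c := (a ^ (n + 1) - b ^ (n + 1)) / (1 - q ^ (n + 1)))
      (h0 := by simp) (hc := by rw [pow_succ]; ring), c1]
  have h1 : ((n : F) + 1) ≠ 0 := by exact_mod_cast Nat.succ_ne_zero n
  have h2 : ((d n : F) + 1) ≠ 0 := by exact_mod_cast Nat.succ_ne_zero (d n)
  push_cast
  rw [mul_inv, mul_inv]
  generalize (a ^ (n + 1) - b ^ (n + 1)) / (1 - q ^ (n + 1)) = x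
  field_simp

theorem coeff_zero_prodSeries (a b q : F) :
    MvPowerSeries.coeff 0 (prodSeries a b q) = 1 := by
  rw [coeff_prodSeries]; simp [zexp]

/-- the shift `p_n ↦ p_n + y_n`. -/
def S (t a b : F) : Sym F →ₐ[F] Sym F :=
  MvPolynomial.aeval fun n =>
    MvPolynomial.X n + MvPolynomial.C ((a ^ (n + 1) - b ^ (n + 1)) / (1 - t ^ (n + 1)))

theorem B_C (q t : F) (G : MvPowerSeries ℕ F) (c : F) :
    B q t G (MvPolynomial.C c) = c * MvPowerSeries.coeff 0 G := by
  rw [← MvPolynomial.monomial_zero', B_monomial, W_zero, mul_one]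

theorem B_adjoint [CharZero F] (q t a b : F) (hq : ∀ n : ℕ, 1 - q ^ (n + 1) ≠ 0)
    (g : Sym F) : ∀ G : MvPowerSeries ℕ F,
    B q t (prodSeries a b q * G) g = B q t G (S t a b g) := by
  induction g using MvPolynomial.induction_on with
  | C c =>
    intro G
    have : S t a b (MvPolynomial.C c) = MvPolynomial.C c := (S t a b).commutes c
    rw [this, B_C, B_C]; simp only [MvPowerSeries.coeff_zero_eq_constantCoeff_apply, map_mul]; rw [← MvPowerSeries.coeff_zero_eq_constantCoeff_apply (prodSeries a b q), coeff_zero_prodSeries, one_mul]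
  | add f g hf hg => intro G; rw [map_add, map_add, map_add, hf, hg]
  | mul_X g n ih =>
    intro G
    have hS : S t a b (MvPolynomial.X n) = MvPolynomial.X n +
        MvPolynomial.C ((a ^ (n + 1) - b ^ (n + 1)) / (1 - t ^ (n + 1))) := by
      simp [S]
    rw [B_mul_X, Derivation.leibniz, pderiv_prodSeries, map_mul, hS, mul_add, map_add, B_mul_X,
      B_add_left, smul_eq_mul, smul_eq_mul, ih, mul_comm G, smul_mul_assoc, B_smul_left, ih,
      mul_comm _ (MvPolynomial.C _), ← MvPolynomial.smul_eq_C_mul, map_smul, smul_eq_mul]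
    have h1 : ((n : F) + 1) ≠ 0 := by exact_mod_cast Nat.succ_ne_zero n
    have h2 := hq n
    have : w1 q t n * c1 a b q n = (a ^ (n + 1) - b ^ (n + 1)) / (1 - t ^ (n + 1)) := by
      rw [w1, c1, div_eq_mul_inv _ (1 - t ^ (n + 1)), div_eq_mul_inv _ (1 - t ^ (n + 1))]
      field_simp
    rw [← this]
    ring

theorem pleth_eq [CharZero F] (q t a b : F) (hq : ∀ n : ℕ, 1 - q ^ (n + 1) ≠ 0) (f : Sym F) :
    plethAB t a b f = B q t (prodSeries a b q) f := by
  have h := B_adjoint q t a b hq f 1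
  rw [mul_one] at h
  rw [h]
  have h2 : ∀ g : Sym F, B q t 1 g = MvPolynomial.eval (fun _ => 0) g := by
    intro g
    induction g using MvPolynomial.induction_on with
    | C c => rw [B_C]; simp
    | add f g hf hg => rw [map_add, map_add, hf, hg]
    | mul_X g n ih =>
      rw [B_mul_X, MvPowerSeries.pderiv_one, map_mul, MvPolynomial.eval_X, mul_zero, B_eq]
      simp
  rw [h2, plethAB]
  induction f using MvPolynomial.induction_on with
  | C c =>
    have : S t a b (MvPolynomial.C c) = MvPolynomial.C c := (S t a b).commutes c
    rw [this]; simp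
  | add f g hf hg =>
    have := B_adjoint q t a b hq
    rw [map_add, map_add, map_add, hf, hg] <;> rw [← this, mul_one]
  | mul_X g n ih =>
    have := B_adjoint q t a b hq
    rw [map_mul, map_mul, map_mul, ih (by rw [← this, mul_one])]
    simp [S]

end pairing

/-! ### Complete symmetric functions span -/

section hspan

variable {F : Type*} [Field F]

/-- homogeneity for the grading in which the variable `n` has degree `n + 1`. -/
abbrev Hom (f : Sym F) (r : ℕ) : Prop :=
  MvPolynomial.IsWeightedHomogeneous (fun n : ℕ => n + 1) f r

theorem weight_eq (d : ℕ →₀ ℕ) : Finsupp.weight (fun n : ℕ => n + 1) d = wt d := by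
  rw [Finsupp.weight_apply, wt]
  refine Finset.sum_congr rfl fun n _ => ?_
  simp [mul_comm]

theorem Hom.wt_eq {f : Sym F} {r : ℕ} (h : Hom f r) {d : ℕ →₀ ℕ}
    (hd : f.coeff d ≠ 0) : wt d = r := by
  rw [← weight_eq]; exact h hd

theorem Hom.of {f : Sym F} {r : ℕ} (h : ∀ d, f.coeff d ≠ 0 → wt d = r) : Hom f r := by
  intro d hd
  rw [weight_eq]; exact h d hd

theorem coeff_hsym (r : ℕ) (d : ℕ →₀ ℕ) :
    MvPolynomial.coeff d (hsym F r) = if wt d = r then (zexp d : F)⁻¹ else 0 := by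
  rw [hsym, coeff_finsum, zee_expo, expo_symm]

theorem hsym_hom (r : ℕ) : Hom (hsym F r) r := by
  apply Hom.of
  intro d hd
  rw [coeff_hsym] at hd
  by_contra h
  simp [h] at hd

theorem hprod_hom (k : Partition) : Hom (hprod F k) k.size :=
  MvPolynomial.IsWeightedHomogeneous.prod _ _ _ fun j _ => hsym_hom (k.part j)

/-- substitution `p_n ↦ h_n`. -/
def Theta (F : Type*) [Field F] : Sym F →ₐ[F] Sym F :=
  MvPolynomial.aeval fun n => hsym F (n + 1)

theorem Theta_monomial (k : Partition) :
    Theta F (MvPolynomial.monomial (expo k) 1) = hprod F k := by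
  rw [← pprod_expo, pprod, map_prod, hprod]
  refine Finset.prod_congr rfl fun j hj => ?_
  have : k.part j ≠ 0 := Finsupp.mem_support_iff.mp hj
  rw [Theta, MvPolynomial.aeval_X]
  congr 1; omega

theorem wt_single (n m : ℕ) : wt (Finsupp.single n m) = (n + 1) * m := by
  rw [wt, Finsupp.sum_single_index (by simp)]

theorem wt_eq_zero {d : ℕ →₀ ℕ} (h : wt d = 0) : d = 0 := by
  ext n
  by_contra hn
  have : (n + 1) * d n ≤ wt d :=
    Finset.single_le_sum (f := fun n => (n + 1) * d n) (by simp) (Finsupp.mem_support_iff.mpr hn)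
  rw [h] at this
  have h3 : 0 < d n := Nat.pos_of_ne_zero hn
  nlinarith

theorem X_mem_range [CharZero F] (n : ℕ) : (MvPolynomial.X n : Sym F) ∈ (Theta F).range := by
  classical
  induction n using Nat.strong_induction_on with
  | _ n ih =>
  have h1 : ((n : F) + 1) ≠ 0 := by exact_mod_cast Nat.succ_ne_zero n
  set R : Sym F := hsym F (n + 1) - MvPolynomial.C ((n : F) + 1)⁻¹ * MvPolynomial.X n with hR
  have hRmem : R ∈ (Theta F).range := by
    rw [R.as_sum]
    refine Subalgebra.sum_mem _ fun d hd => ?_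
    rw [MvPolynomial.monomial_eq]
    refine Subalgebra.mul_mem _ ((Theta F).range.algebraMap_mem _) ?_
    refine Subalgebra.prod_mem _ fun i hi => Subalgebra.pow_mem _ (ih i ?_) _
    have hc : R.coeff d ≠ 0 := MvPolynomial.mem_support_iff.mp hd
    rw [hR, MvPolynomial.coeff_sub, MvPolynomial.coeff_C_mul, MvPolynomial.coeff_X,
      coeff_hsym] at hc
    by_contra hin
    push Not at hin
    have hle : Finsupp.single i 1 ≤ d := by
      rw [Finsupp.single_le_iff]
      exact Nat.one_le_iff_ne_zero.mpr (Finsupp.mem_support_iff.mp hi)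
    have hd2 := tsub_add_cancel_of_le hle
    have hw : wt d = wt (d - Finsupp.single i 1) + (i + 1) := by
      conv_lhs => rw [← hd2, wt_add, wt_single, mul_one]
    by_cases hwd : wt d = n + 1
    · have hz : wt (d - Finsupp.single i 1) = 0 := by omega
      have hin' : i = n := by omega
      rw [wt_eq_zero hz, zero_add, hin'] at hd2
      rw [if_pos hwd, if_pos hd2, ← hd2] at hc
      apply hc
      rw [zexp, Finsupp.prod_single_index (by simp)]
      simp
    · rw [if_neg hwd, if_neg] at hc
      · simp at hc
      · intro h
        rw [← h, wt_single] at hwd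
        omega
  have hh : hsym F (n + 1) ∈ (Theta F).range :=
    ⟨MvPolynomial.X n, by simp [Theta]⟩
  have hX : (MvPolynomial.X n : Sym F) =
      MvPolynomial.C ((n : F) + 1) * (hsym F (n + 1) - R) := by
    rw [hR, sub_sub_cancel, ← mul_assoc, ← MvPolynomial.C_mul, mul_inv_cancel₀ h1,
      MvPolynomial.C_1, one_mul]
  rw [hX]
  exact Subalgebra.mul_mem _ ((Theta F).range.algebraMap_mem _) (Subalgebra.sub_mem _ hh hRmem)

theorem Theta_surjective [CharZero F] : Function.Surjective (Theta F) := by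
  intro g
  have : g ∈ (Theta F).range := by
    induction g using MvPolynomial.induction_on with
    | C c => exact (Theta F).range.algebraMap_mem _
    | add f g hf hg => exact Subalgebra.add_mem _ hf hg
    | mul_X g n ih => exact Subalgebra.mul_mem _ ih (X_mem_range n)
  exact this

theorem linear_zero_of_hprod [CharZero F] (L : Sym F →ₗ[F] F) (h : ∀ k, L (hprod F k) = 0)
    (g : Sym F) : L g = 0 := by
  obtain ⟨f, rfl⟩ := Theta_surjective g
  induction f using MvPolynomial.induction_on' with
  | monomial d c =>
    have e : MvPolynomial.monomial d c =
        c • MvPolynomial.monomial (expo (expoEquiv.symm d)) (1 : F) := by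
      rw [MvPolynomial.smul_monomial, smul_eq_mul, mul_one, expo_symm]
    rw [e, map_smul, map_smul, Theta_monomial, h, smul_zero]
  | add f g hf hg => rw [map_add, map_add, hf, hg, add_zero]

theorem inner_hom_zero (q t : F) {f g : Sym F} {r s : ℕ} (hf : Hom f r) (hg : Hom g s)
    (h : r ≠ s) : innerQT q t f g = 0 := by
  refine Finset.sum_eq_zero fun d hd => ?_
  have h1 := hf.wt_eq (MvPolynomial.mem_support_iff.mp hd)
  have h2 : g.coeff d = 0 := by
    by_contra hc
    exact h (h1.symm.trans (hg.wt_eq hc))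
  rw [h2]; ring

/-- the form as a linear map in its second argument -/
theorem inner_add_right (q t : F) (f g h : Sym F) :
    innerQT q t f (g + h) = innerQT q t f g + innerQT q t f h := by
  simp only [inner_eq_B, map_add]

theorem inner_smul_right (q t : F) (c : F) (f g : Sym F) :
    innerQT q t f (c • g) = c * innerQT q t f g := by
  simp only [inner_eq_B, map_smul, smul_eq_mul]

theorem inner_smul_left (q t : F) (c : F) (f g : Sym F) :
    innerQT q t (c • f) g = c * innerQT q t f g := by
  rw [inner_comm, inner_smul_right, inner_comm]

theorem inner_sum_right {ι : Type*} (q t : F) (s : Finset ι) (f : Sym F) (g : ι → Sym F) :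
    innerQT q t f (∑ i ∈ s, g i) = ∑ i ∈ s, innerQT q t f (g i) := by
  simp only [inner_eq_B, map_sum]

theorem inner_sum_left {ι : Type*} (q t : F) (s : Finset ι) (f : Sym F) (g : ι → Sym F) :
    innerQT q t (∑ i ∈ s, g i) f = ∑ i ∈ s, innerQT q t (g i) f := by
  rw [inner_comm, inner_sum_right]
  exact Finset.sum_congr rfl fun i _ => inner_comm _ _ _ _

theorem eq_zero_of_inner [CharZero F] (q t : F) (hq : ∀ n : ℕ, 1 - q ^ (n + 1) ≠ 0)
    (ht : ∀ n : ℕ, 1 - t ^ (n + 1) ≠ 0) (f : Sym F) (h : ∀ g, innerQT q t f g = 0) : f = 0 := by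
  ext d
  have := h (MvPolynomial.monomial d 1)
  rw [inner_eq_B, B_monomial, MvPolynomial.coeff_coe, one_mul] at this
  rw [MvPolynomial.coeff_zero]
  exact (mul_eq_zero.mp this).resolve_right (W_ne_zero q t hq ht d)

end hspan

/-! ### The Macdonald family is an orthogonal homogeneous basis -/

section macdonald

variable {F : Type*} [Field F] [CharZero F] {q t : F} {P : Partition → Sym F}

theorem P_hom (ht : ∀ n : ℕ, 1 - t ^ (n + 1) ≠ 0) (hP : IsMacdonald q t P) (lam : Partition) :
    Hom (P lam) lam.size := by
  classical
  apply Hom.of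
  intro d hd
  by_contra hne
  set f : Sym F := MvPolynomial.weightedHomogeneousComponent (fun n : ℕ => n + 1) (wt d) (P lam)
    with hf
  have hcf : ∀ e, f.coeff e = if wt e = wt d then (P lam).coeff e else 0 := by
    intro e
    rw [hf, MvPolynomial.coeff_weightedHomogeneousComponent, weight_eq]
  have hfh : Hom f (wt d) := MvPolynomial.weightedHomogeneousComponent_isWeightedHomogeneous _ _
  have h0 : f = 0 := by
    apply eq_zero_of_inner t t ht ht
    intro g
    rw [inner_eq_B]
    apply linear_zero_of_hprod
    intro k
    rw [← inner_eq_B]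
    by_cases hk : wt d = k.size
    · have : innerQT t t f (hprod F k) = innerQT t t (P lam) (hprod F k) := by
        rw [inner_eq_B, inner_eq_B]
        apply B_congr
        intro e he
        rw [MvPolynomial.coeff_coe, MvPolynomial.coeff_coe, hcf, if_pos]
        rw [hk]
        exact (hprod_hom k).wt_eq (MvPolynomial.mem_support_iff.mp he)
      rw [this]
      apply hP.2.2
      intro hdom
      exact hne (hk.trans hdom.1)
    · exact inner_hom_zero _ _ hfh (hprod_hom k) hk
  have := hcf d
  rw [h0, if_pos rfl, MvPolynomial.coeff_zero] at this
  exact hd this.symm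

theorem psum_inj {k l : Partition} (h : k.psum = l.psum) : k = l := by
  apply part_ext
  intro j
  have h1 := congrFun h j
  have h2 := congrFun h (j + 1)
  simp only [Partition.psum, Finset.sum_range_succ] at h1 h2
  omega

theorem P_linearIndependent (hP : IsMacdonald q t P) : LinearIndependent F P := by
  classical
  rw [linearIndependent_iff']
  intro s g hg
  by_contra hcon
  push Not at hcon
  obtain ⟨i, his, hi⟩ := hcon
  obtain ⟨l, hl, hmax⟩ := Finset.exists_maximalFor Partition.psum (s.filter fun i => g i ≠ 0)
    ⟨i, by simp [his, hi]⟩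
  simp only [Finset.mem_coe, Finset.mem_filter] at hl hmax
  apply hl.2
  have h1 : innerQT t t (∑ i ∈ s, g i • P i) (hprod F l) = 0 := by
    rw [hg]; simp [innerQT]
  rw [inner_sum_left, Finset.sum_eq_single l] at h1
  · rwa [inner_smul_left, hP.2.1, mul_one] at h1
  · intro k hk hkl
    rw [inner_smul_left]
    by_cases hgk : g k = 0
    · rw [hgk, zero_mul]
    rw [hP.2.2, mul_zero]
    intro hdom
    apply hkl
    apply psum_inj
    exact le_antisymm (hmax ⟨hk, hgk⟩ hdom.2) hdom.2
  · intro h; exact absurd hl.1 h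

theorem P_span (ht : ∀ n : ℕ, 1 - t ^ (n + 1) ≠ 0) (hP : IsMacdonald q t P) :
    ⊤ ≤ Submodule.span F (Set.range P) := by
  classical
  have key : ∀ d : ℕ →₀ ℕ, MvPolynomial.monomial d (1 : F) ∈ Submodule.span F (Set.range P) := by
    intro d
    let ι := {k : Partition // k.size = wt d}
    have : Fintype ι := (size_finite (wt d)).fintype
    let v : ι → (ι → F) := fun k l => (P k.1).coeff (expo l.1)
    have ext0 : ∀ f : Sym F, Hom f (wt d) → (∀ l : ι, f.coeff (expo l.1) = 0) → f = 0 := by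
      intro f hf h
      ext e
      rw [MvPolynomial.coeff_zero]
      by_contra he
      have hw := hf.wt_eq he
      apply he
      have := h ⟨expoEquiv.symm e, by rw [← wt_expo, expo_symm, hw]⟩
      rwa [expo_symm] at this
    have homsum : ∀ g : ι → F, Hom (∑ i, g i • P i.1) (wt d) := by
      intro g
      apply MvPolynomial.IsWeightedHomogeneous.sum
      intro i _
      rw [MvPolynomial.smul_eq_C_mul]
      have := (P_hom ht hP i.1).C_mul (g i)
      rwa [i.2] at this
    have hv : LinearIndependent F v := by
      rw [Fintype.linearIndependent_iff]
      intro g hg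
      have h0 : ∑ i, g i • P i.1 = 0 := by
        apply ext0 _ (homsum g)
        intro l
        have := congrFun hg l
        simp only [Finset.sum_apply, Pi.smul_apply, smul_eq_mul, Pi.zero_apply, v] at this
        rw [MvPolynomial.coeff_sum]
        simpa only [MvPolynomial.coeff_smul, smul_eq_mul] using this
      exact (Fintype.linearIndependent_iff.mp
        ((P_linearIndependent hP).comp (Subtype.val : ι → Partition) Subtype.val_injective)) g h0
    have hsp := hv.span_eq_top_of_card_eq_finrank' (by simp)
    have hmem : (fun l : ι => MvPolynomial.coeff (expo l.1) (MvPolynomial.monomial d (1 : F))) ∈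
        Submodule.span F (Set.range v) := by rw [hsp]; trivial
    obtain ⟨c, hc⟩ := (Submodule.mem_span_range_iff_exists_fun F).mp hmem
    have : MvPolynomial.monomial d (1 : F) - ∑ i, c i • P i.1 = 0 := by
      apply ext0
      · refine MvPolynomial.IsWeightedHomogeneous.sub ?_ (homsum c)
        exact MvPolynomial.isWeightedHomogeneous_monomial _ _ _ (weight_eq d)
      · intro l
        have h := congrFun hc l
        simp only [Finset.sum_apply, Pi.smul_apply, smul_eq_mul, v] at h
        rw [MvPolynomial.coeff_sub, ← h, MvPolynomial.coeff_sum]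
        simp only [MvPolynomial.coeff_smul, smul_eq_mul, sub_self]
    rw [sub_eq_zero.mp this]
    exact Submodule.sum_mem _ fun i _ => Submodule.smul_mem _ _ (Submodule.subset_span ⟨i.1, rfl⟩)
  intro g _
  rw [g.as_sum]
  refine Submodule.sum_mem _ fun d _ => ?_
  have e : MvPolynomial.monomial d (g.coeff d) = g.coeff d • MvPolynomial.monomial d (1 : F) := by
    rw [MvPolynomial.smul_monomial, smul_eq_mul, mul_one]
  rw [e]
  exact Submodule.smul_mem _ _ (key d)

/-- the Macdonald basis -/
def Pb (ht : ∀ n : ℕ, 1 - t ^ (n + 1) ≠ 0) (hP : IsMacdonald q t P) :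
    Module.Basis Partition F (Sym F) :=
  Module.Basis.mk (P_linearIndependent hP) (P_span ht hP)

theorem inner_repr (ht : ∀ n : ℕ, 1 - t ^ (n + 1) ≠ 0) (hP : IsMacdonald q t P) (g : Sym F)
    (lam : Partition) :
    innerQT q t (P lam) g = (Pb ht hP).repr g lam * innerQT q t (P lam) (P lam) := by
  have hg := (Pb ht hP).linearCombination_repr g
  conv_lhs => rw [← hg, Finsupp.linearCombination_apply, Finsupp.sum, inner_sum_right]
  simp only [inner_smul_right, Pb, Module.Basis.mk_apply]
  rw [Finset.sum_eq_single lam]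
  · intro k _ hk
    rw [hP.1 lam k hk.symm, mul_zero]
  · intro h
    rw [Finsupp.notMem_support_iff.mp h, zero_mul]

theorem norm_ne_zero (hq : ∀ n : ℕ, 1 - q ^ (n + 1) ≠ 0)
    (ht : ∀ n : ℕ, 1 - t ^ (n + 1) ≠ 0) (hP : IsMacdonald q t P) (lam : Partition) :
    innerQT q t (P lam) (P lam) ≠ 0 := by
  intro h
  have h0 : P lam = 0 := by
    apply eq_zero_of_inner q t hq ht
    intro g
    rw [inner_repr ht hP, h, mul_zero]
  have := hP.2.1 lam
  rw [h0] at this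
  simp [innerQT] at this

theorem finite_support (ht : ∀ n : ℕ, 1 - t ^ (n + 1) ≠ 0) (hP : IsMacdonald q t P) (g : Sym F) :
    (Function.support fun lam => innerQT q t (P lam) g).Finite := by
  refine ((Pb ht hP).repr g).support.finite_toSet.subset ?_
  intro lam h
  rw [Finset.mem_coe, Finsupp.mem_support_iff]
  intro h0
  apply h
  change innerQT q t (P lam) g = 0
  rw [inner_repr ht hP, h0, zero_mul]

theorem expand (hq : ∀ n : ℕ, 1 - q ^ (n + 1) ≠ 0)
    (ht : ∀ n : ℕ, 1 - t ^ (n + 1) ≠ 0) (hP : IsMacdonald q t P) (L : Sym F →ₗ[F] F) (g : Sym F) :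
    ∑ᶠ lam, innerQT q t (P lam) g * L (macQ q t P lam) = L g := by
  have hterm : ∀ lam, innerQT q t (P lam) g * L (macQ q t P lam) =
      (Pb ht hP).repr g lam * L (P lam) := by
    intro lam
    rw [inner_repr ht hP, macQ, bnorm, map_smul, smul_eq_mul]
    have := norm_ne_zero hq ht hP lam
    field_simp
  simp only [hterm]
  rw [finsum_eq_sum_of_support_subset (s := ((Pb ht hP).repr g).support)]
  · have hg := (Pb ht hP).linearCombination_repr g
    conv_rhs => rw [← hg, Finsupp.linearCombination_apply, Finsupp.sum, map_sum]
    simp only [map_smul, Pb, Module.Basis.mk_apply, smul_eq_mul]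
  · intro lam h
    rw [Finset.mem_coe, Finsupp.mem_support_iff]
    intro h0
    apply h
    change (Pb ht hP).repr g lam * L (P lam) = 0
    rw [h0, zero_mul]

theorem expand' (hq : ∀ n : ℕ, 1 - q ^ (n + 1) ≠ 0)
    (ht : ∀ n : ℕ, 1 - t ^ (n + 1) ≠ 0) (hP : IsMacdonald q t P) (L : Sym F →ₗ[F] F) (g : Sym F) :
    ∑ᶠ lam, innerQT q t (macQ q t P lam) g * L (P lam) = L g := by
  rw [← expand hq ht hP L g]
  refine finsum_congr fun lam => ?_
  rw [macQ, inner_smul_left, map_smul, smul_eq_mul]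
  ring

theorem Q_hom (ht : ∀ n : ℕ, 1 - t ^ (n + 1) ≠ 0) (hP : IsMacdonald q t P) (lam : Partition) :
    Hom (macQ q t P lam) lam.size := by
  rw [macQ, MvPolynomial.smul_eq_C_mul]
  exact (P_hom ht hP lam).C_mul _

theorem finite_deg {f g : Sym F} {u : Partition → Sym F} {r s : ℕ} (hf : Hom f r)
    (hg : Hom g s) (hu : ∀ k, Hom (u k) k.size) :
    (Function.support fun k => innerQT q t f (g * u k)).Finite := by
  refine (size_finite (r - s)).subset ?_
  intro k hk
  change k.size = r - s
  by_contra hne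
  apply hk
  apply inner_hom_zero q t hf (hg.mul (hu k))
  omega

theorem inner_skewP (hq : ∀ n : ℕ, 1 - q ^ (n + 1) ≠ 0)
    (ht : ∀ n : ℕ, 1 - t ^ (n + 1) ≠ 0) (hP : IsMacdonald q t P) (lam mu : Partition)
    (g : Sym F) :
    innerQT q t (skewP q t P lam mu) g = innerQT q t (P lam) (macQ q t P mu * g) := by
  have hfin := finite_deg (q := q) (t := t) (P_hom ht hP lam) (Q_hom ht hP mu) (Q_hom ht hP)
  have h1 : skewP q t P lam mu = ∑ nu ∈ hfin.toFinset,
      innerQT q t (P lam) (macQ q t P mu * macQ q t P nu) • P nu := by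
    rw [skewP]
    apply finsum_eq_sum_of_support_subset
    intro nu hnu
    rw [Finset.mem_coe, Set.Finite.mem_toFinset]
    intro h0
    apply hnu
    change innerQT q t (P lam) (macQ q t P mu * macQ q t P nu) = 0 at h0
    change innerQT q t (P lam) (macQ q t P mu * macQ q t P nu) • P nu = 0
    rw [h0, zero_smul]
  let L : Sym F →ₗ[F] F := (B q t (P lam : MvPowerSeries ℕ F)).comp
    (LinearMap.mulLeft F (macQ q t P mu))
  have hL : ∀ f, innerQT q t (P lam) (macQ q t P mu * f) = L f := by
    intro f; rw [inner_eq_B]; rfl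
  rw [h1, inner_sum_left, hL g, ← expand hq ht hP L g,
    finsum_eq_sum_of_support_subset (s := hfin.toFinset)]
  · refine Finset.sum_congr rfl fun nu _ => ?_
    rw [inner_smul_left, hL, mul_comm]
  · intro nu hnu
    rw [Finset.mem_coe, Set.Finite.mem_toFinset]
    intro h0
    apply hnu
    change innerQT q t (P lam) (macQ q t P mu * macQ q t P nu) = 0 at h0
    change innerQT q t (P nu) g * L (macQ q t P nu) = 0
    rw [← hL, h0, mul_zero]

theorem inner_skewQ (hq : ∀ n : ℕ, 1 - q ^ (n + 1) ≠ 0)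
    (ht : ∀ n : ℕ, 1 - t ^ (n + 1) ≠ 0) (hP : IsMacdonald q t P) (lam mu : Partition)
    (g : Sym F) :
    innerQT q t (skewQ q t P lam mu) g = innerQT q t (macQ q t P lam) (P mu * g) := by
  have hfin := finite_deg (q := q) (t := t) (Q_hom ht hP lam) (P_hom ht hP mu) (P_hom ht hP)
  have h1 : skewQ q t P lam mu = ∑ nu ∈ hfin.toFinset,
      innerQT q t (macQ q t P lam) (P mu * P nu) • macQ q t P nu := by
    rw [skewQ]
    apply finsum_eq_sum_of_support_subset
    intro nu hnu
    rw [Finset.mem_coe, Set.Finite.mem_toFinset]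
    intro h0
    apply hnu
    change innerQT q t (macQ q t P lam) (P mu * P nu) = 0 at h0
    change innerQT q t (macQ q t P lam) (P mu * P nu) • macQ q t P nu = 0
    rw [h0, zero_smul]
  let L : Sym F →ₗ[F] F := (B q t (macQ q t P lam : MvPowerSeries ℕ F)).comp
    (LinearMap.mulLeft F (P mu))
  have hL : ∀ f, innerQT q t (macQ q t P lam) (P mu * f) = L f := by
    intro f; rw [inner_eq_B]; rfl
  rw [h1, inner_sum_left, hL g, ← expand' hq ht hP L g,
    finsum_eq_sum_of_support_subset (s := hfin.toFinset)]
  · refine Finset.sum_congr rfl fun nu _ => ?_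
    rw [inner_smul_left, hL, mul_comm]
  · intro nu hnu
    rw [Finset.mem_coe, Set.Finite.mem_toFinset]
    intro h0
    apply hnu
    change innerQT q t (macQ q t P lam) (P mu * P nu) = 0 at h0
    change innerQT q t (macQ q t P nu) g * L (P nu) = 0
    rw [← hL, h0, mul_zero]

/-- `Q_{λ/μ}[Y] = ⟨P_μ, Q_λ[X + Y]⟩`. -/
theorem pleth_skewQ (hq : ∀ n : ℕ, 1 - q ^ (n + 1) ≠ 0)
    (ht : ∀ n : ℕ, 1 - t ^ (n + 1) ≠ 0) (hP : IsMacdonald q t P) (a b : F)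
    (lam mu : Partition) :
    plethAB t a b (skewQ q t P lam mu) = innerQT q t (P mu) (S t a b (macQ q t P lam)) := by
  classical
  rw [pleth_eq q t a b hq, inner_eq_B, ← B_adjoint q t a b hq]
  set N : ℕ →₀ ℕ := (skewQ q t P lam mu).support.sup id ⊔ (macQ q t P lam).support.sup id with hN
  set T : Sym F := MvPowerSeries.trunc' F N (prodSeries a b q) with hT
  have hTc : ∀ d, d ≤ N → MvPowerSeries.coeff d (prodSeries a b q) =
      MvPowerSeries.coeff d (T : MvPowerSeries ℕ F) := by
    intro d hd
    rw [MvPolynomial.coeff_coe, hT, MvPowerSeries.coeff_trunc', if_pos hd]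
  have e1 : B q t (prodSeries a b q) (skewQ q t P lam mu) =
      B q t (T : MvPowerSeries ℕ F) (skewQ q t P lam mu) := by
    apply B_congr
    intro d hd
    apply hTc
    exact (Finset.le_sup (f := id) hd).trans le_sup_left
  have e2 : B q t (prodSeries a b q * (P mu : MvPowerSeries ℕ F)) (macQ q t P lam) =
      B q t ((T * P mu : Sym F) : MvPowerSeries ℕ F) (macQ q t P lam) := by
    apply B_congr
    intro d hd
    rw [MvPolynomial.coe_mul, MvPowerSeries.coeff_mul, MvPowerSeries.coeff_mul]
    refine Finset.sum_congr rfl fun x hx => ?_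
    rw [hTc]
    have h1 : x.1 ≤ d := by
      rw [← Finset.HasAntidiagonal.mem_antidiagonal.mp hx]
      exact le_self_add
    exact h1.trans ((Finset.le_sup (f := id) hd).trans le_sup_right)
  rw [e1, e2, ← inner_eq_B, ← inner_eq_B, inner_comm, inner_skewQ hq ht hP, inner_comm,
    mul_comm T]

theorem main_general (hq : ∀ n : ℕ, 1 - q ^ (n + 1) ≠ 0)
    (ht : ∀ n : ℕ, 1 - t ^ (n + 1) ≠ 0) (hP : IsMacdonald q t P) (a b : F)
    (mu nu : Partition) :
    sumSeries (fun lam => plethAB t a b (skewQ q t P lam nu))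
        (fun lam => skewP q t P lam mu) =
      prodSeries a b q *
        sumSeries (fun lam => plethAB t a b (skewQ q t P mu lam))
          (fun lam => skewP q t P nu lam) := by
  classical
  have hcs : ∀ (c : Partition → F) (g : Partition → Sym F) (d : ℕ →₀ ℕ),
      MvPowerSeries.coeff d (sumSeries c g) = ∑ᶠ i, c i * (g i).coeff d := fun _ _ _ => rfl
  have hmono : ∀ (f : Sym F) (d : ℕ →₀ ℕ),
      f.coeff d * W q t d = innerQT q t f (MvPolynomial.monomial d 1) := by
    intro f d
    rw [inner_eq_B, B_monomial, one_mul, MvPolynomial.coeff_coe]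
  -- the right-hand sum paired with a polynomial
  have hR : ∀ g : Sym F, B q t (sumSeries (fun lam => plethAB t a b (skewQ q t P mu lam))
      (fun lam => skewP q t P nu lam)) g =
        innerQT q t (P nu) (S t a b (macQ q t P mu) * g) := by
    intro g
    let L : Sym F →ₗ[F] F := (B q t (P nu : MvPowerSeries ℕ F)).comp (LinearMap.mulRight F g)
    have hL : ∀ f, innerQT q t (P nu) (f * g) = L f := by
      intro f; rw [inner_eq_B]; rfl
    have hfin := finite_support ht hP (S t a b (macQ q t P mu))
    rw [hL, ← expand hq ht hP L,
      finsum_eq_sum_of_support_subset (s := hfin.toFinset)]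
    · rw [B_eq]
      have hco : ∀ d, MvPowerSeries.coeff d (sumSeries
          (fun lam => plethAB t a b (skewQ q t P mu lam)) (fun lam => skewP q t P nu lam)) =
          ∑ lam ∈ hfin.toFinset, innerQT q t (P lam) (S t a b (macQ q t P mu)) *
            (skewP q t P nu lam).coeff d := by
        intro d
        rw [hcs, finsum_eq_sum_of_support_subset (s := hfin.toFinset)]
        · refine Finset.sum_congr rfl fun lam _ => ?_
          rw [pleth_skewQ hq ht hP]
        · intro lam hlam
          rw [Finset.mem_coe, Set.Finite.mem_toFinset]
          intro h0
          apply hlam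
          change innerQT q t (P lam) (S t a b (macQ q t P mu)) = 0 at h0
          change plethAB t a b (skewQ q t P mu lam) * _ = 0
          rw [pleth_skewQ hq ht hP, h0, zero_mul]
      simp only [hco, Finset.sum_mul, Finset.mul_sum]
      rw [Finset.sum_comm]
      refine Finset.sum_congr rfl fun lam _ => ?_
      rw [← hL, ← inner_skewP hq ht hP, inner_eq_B q t (skewP q t P nu lam), B_eq,
        Finset.mul_sum]
      refine Finset.sum_congr rfl fun d _ => ?_
      rw [MvPolynomial.coeff_coe]
      ring
    · intro lam hlam
      rw [Finset.mem_coe, Set.Finite.mem_toFinset]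
      intro h0
      apply hlam
      change innerQT q t (P lam) (S t a b (macQ q t P mu)) = 0 at h0
      change innerQT q t (P lam) (S t a b (macQ q t P mu)) * _ = 0
      rw [h0, zero_mul]
  ext d
  have hW := W_ne_zero q t hq ht d
  apply mul_right_cancel₀ hW
  have hr := B_monomial q t (prodSeries a b q *
        sumSeries (fun lam => plethAB t a b (skewQ q t P mu lam))
          (fun lam => skewP q t P nu lam)) d 1
  rw [one_mul] at hr
  rw [← hr, B_adjoint q t a b hq, hR, ← map_mul, hcs, finsum_mul']
  · let L : Sym F →ₗ[F] F := (B q t (P nu : MvPowerSeries ℕ F)).comp (S t a b).toLinearMap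
    have hL : ∀ f, innerQT q t (P nu) (S t a b f) = L f := by
      intro f; rw [inner_eq_B]; rfl
    rw [hL, ← expand hq ht hP L]
    refine finsum_congr fun lam => ?_
    rw [mul_assoc, hmono, inner_skewP hq ht hP, pleth_skewQ hq ht hP, hL, mul_comm]
  · refine (finite_support ht hP (macQ q t P mu * MvPolynomial.monomial d 1)).subset ?_
    intro lam hlam h0
    apply hlam
    change innerQT q t (P lam) (macQ q t P mu * MvPolynomial.monomial d 1) = 0 at h0
    change _ * (skewP q t P lam mu).coeff d = 0
    rw [← inner_skewP hq ht hP, ← hmono] at h0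
    rw [(mul_eq_zero.mp h0).resolve_right hW, mul_zero]

end macdonald

/-! ### Genericity of the parameters -/

theorem one_sub_X_pow_ne {K : Type*} [Field K] (n : ℕ) :
    (1 : RatFunc K) - RatFunc.X ^ (n + 1) ≠ 0 := by
  intro h
  have h2 : algebraMap (Polynomial K) (RatFunc K) (1 - Polynomial.X ^ (n + 1)) = 0 := by
    rw [map_sub, map_pow, map_one, RatFunc.algebraMap_X, h]
  rw [map_eq_zero_iff _ (RatFunc.algebraMap_injective K)] at h2
  have := congrArg (Polynomial.eval 0) h2
  simp at this

theorem one_sub_C_pow_ne {K : Type*} [Field K] (x : K) (n : ℕ) (hx : 1 - x ^ (n + 1) ≠ 0) :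
    (1 : RatFunc K) - RatFunc.C x ^ (n + 1) ≠ 0 := by
  rw [← map_one RatFunc.C, ← map_pow, ← map_sub]
  exact (map_ne_zero _).mpr hx

theorem charZero_ratFunc (K : Type*) [Field K] [CharZero K] : CharZero (RatFunc K) :=
  charZero_of_injective_ringHom (f := (RatFunc.C : K →+* RatFunc K)) (RingHom.injective _)

/-- The `q`-binomial theorem for Macdonald polynomials
(Lascoux--Warnaar): for all partitions `μ, ν` and parameters `a, b`,
`∑_λ Q_{λ/ν}((a-b)/(1-t)) P_{λ/μ}(X;q,t)
  = (∏_{x ∈ X} (bx;q)_∞/(ax;q)_∞) ∑_λ Q_{μ/λ}((a-b)/(1-t)) P_{ν/λ}(X;q,t)`,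
as an identity of symmetric formal power series. -/
theorem qbinomial_theorem_macdonald
    (P : Partition → Sym F4) (hP : IsMacdonald q4 t4 P) (mu nu : Partition) :
    sumSeries (fun lam => plethAB t4 a4 b4 (skewQ q4 t4 P lam nu))
        (fun lam => skewP q4 t4 P lam mu) =
      prodSeries a4 b4 q4 *
        sumSeries (fun lam => plethAB t4 a4 b4 (skewQ q4 t4 P mu lam))
          (fun lam => skewP q4 t4 P nu lam) := by
  have h1 : CharZero F1 := charZero_ratFunc ℚ
  have h2 : CharZero F2 := charZero_ratFunc F1
  have h3 : CharZero F3 := charZero_ratFunc F2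
  have h4 : CharZero F4 := charZero_ratFunc F3
  refine main_general ?_ ?_ hP a4 b4 mu nu
  · intro n
    exact one_sub_C_pow_ne _ _ (one_sub_C_pow_ne _ _ (one_sub_X_pow_ne n))
  · intro n
    exact one_sub_C_pow_ne _ _ (one_sub_C_pow_ne _ _ (one_sub_C_pow_ne _ _ (one_sub_X_pow_ne n)))

end SkewPieriFormalization
end
end

section
/- Orthogonality of plethystically evaluated skew Macdonald Q-functions: for all partitions λ, μ and parameters a, b, Σ_ν Q_{λ/ν}((a−b)/(1−t)) Q_{ν/μ}((b−a)/(1−t)) = δ_{λμ}, where the sum is over all partitions ν and δ_{λμ} is the Kronecker delta. -/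
/-!
Common framework: integer partitions, Gaussian binomials, Hall--Littlewood
Pieri coefficients, the ring of symmetric functions realized as polynomials
in the power sums, the Macdonald `(q,t)`-inner product, a characterisation
of the Macdonald polynomials `P_λ(X;q,t)`, skew Macdonald polynomials,
plethystic evaluations and the various Pieri coefficients of
Konvalinka--Lauve and Warnaar.
-/

open scoped BigOperators

noncomputable section

namespace SkewPieriFormalization

variable {F : Type*} [Field F]

/-! ### Helper lemmas -/

namespace Aux

open MvPolynomial

/-- the norm of the power sum monomial `p_d`. -/
def zz (q t : F) (d : ℕ →₀ ℕ) : F :=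
  d.prod fun n m =>
        (((n : F) + 1) ^ m * (Nat.factorial m : F)) *
          ((1 - q ^ (n + 1)) / (1 - t ^ (n + 1))) ^ m

/-- adjoint weight. -/
def ww (q t : F) (n : ℕ) : F := ((n : F) + 1) * ((1 - q ^ (n + 1)) / (1 - t ^ (n + 1)))

lemma inner_eq (q t : F) (f g : Sym F) (S : Finset (ℕ →₀ ℕ)) (h : f.support ⊆ S) :
    innerQT q t f g = ∑ d ∈ S, f.coeff d * g.coeff d * zz q t d := by
  unfold innerQT zz
  apply Finset.sum_subset h
  intro d _ hd
  rw [MvPolynomial.notMem_support_iff.mp hd]; simp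

lemma inner_comm (q t : F) (f g : Sym F) : innerQT q t f g = innerQT q t g f := by
  classical
  rw [inner_eq q t f g (f.support ∪ g.support) Finset.subset_union_left,
    inner_eq q t g f (f.support ∪ g.support) Finset.subset_union_right]
  refine Finset.sum_congr rfl fun d _ => by ring

lemma inner_add_right (q t : F) (f g h : Sym F) :
    innerQT q t f (g + h) = innerQT q t f g + innerQT q t f h := by
  simp only [inner_eq q t f _ _ subset_rfl, MvPolynomial.coeff_add, ← Finset.sum_add_distrib]
  refine Finset.sum_congr rfl fun d _ => by ring

lemma inner_smul_right (q t : F) (f g : Sym F) (c : F) :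
    innerQT q t f (c • g) = c * innerQT q t f g := by
  simp only [inner_eq q t f _ _ subset_rfl, MvPolynomial.coeff_smul, Finset.mul_sum, smul_eq_mul]
  refine Finset.sum_congr rfl fun d _ => by ring

/-- `innerQT` as a linear map in the right argument. -/
def ipR (q t : F) (f : Sym F) : Sym F →ₗ[F] F where
  toFun := innerQT q t f
  map_add' := inner_add_right q t f
  map_smul' c g := by simp [inner_smul_right]

/-- `innerQT` as a linear map in the left argument. -/
def ipL (q t : F) (g : Sym F) : Sym F →ₗ[F] F where
  toFun f := innerQT q t f g
  map_add' f f' := by simp only [inner_comm q t _ g, inner_add_right]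
  map_smul' c f := by simp only [inner_comm q t _ g, inner_smul_right]; rfl

lemma ipR_apply (q t : F) (f g : Sym F) : ipR q t f g = innerQT q t f g := rfl
lemma ipL_apply (q t : F) (f g : Sym F) : ipL q t g f = innerQT q t f g := rfl

lemma inner_add_left (q t : F) (f g h : Sym F) :
    innerQT q t (f + g) h = innerQT q t f h + innerQT q t g h := (ipL q t h).map_add f g

lemma inner_smul_left (q t : F) (f g : Sym F) (c : F) :
    innerQT q t (c • f) g = c * innerQT q t f g := (ipL q t g).map_smul c f

lemma inner_monomial (q t : F) (f : Sym F) (d : ℕ →₀ ℕ) (a : F) :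
    innerQT q t f (monomial d a) = f.coeff d * a * zz q t d := by
  classical
  rw [inner_comm, inner_eq q t _ f {d} (MvPolynomial.support_monomial_subset)]
  simp [mul_comm]

lemma zz_single_add (q t : F) (n : ℕ) (e : ℕ →₀ ℕ) :
    zz q t (Finsupp.single n 1 + e) = ww q t n * ((e n : F) + 1) * zz q t e := by
  classical
  unfold zz
  rw [← Finsupp.mul_prod_erase' (Finsupp.single n 1 + e) n _ (by simp),
    ← Finsupp.mul_prod_erase' e n _ (by simp)]
  have : (Finsupp.single n 1 + e).erase n = e.erase n := by
    ext i
    by_cases h : i = n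
    · simp [h]
    · simp [Finsupp.erase_ne h, Finsupp.single_apply, Ne.symm h]
  rw [this]
  simp only [Finsupp.add_apply, Finsupp.single_eq_same, ww]
  rw [add_comm 1 (e n), Nat.factorial_succ]
  push_cast
  ring

lemma inner_X_mul (q t : F) (n : ℕ) (f g : Sym F) :
    innerQT q t f (X n * g) = ww q t n * innerQT q t (pderiv n f) g := by
  classical
  induction g using MvPolynomial.induction_on' with
  | monomial e b =>
    have : (X n * monomial e b : Sym F) = monomial (Finsupp.single n 1 + e) b := by
      rw [X, monomial_mul, one_mul]
    rw [this, inner_monomial, inner_monomial, zz_single_add]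
    have hc : coeff e (pderiv n f) = coeff (Finsupp.single n 1 + e) f * ((e n : F) + 1) := by
      induction f using MvPolynomial.induction_on' with
      | monomial d a =>
        rw [pderiv_monomial, coeff_monomial, coeff_monomial]
        by_cases h : d = Finsupp.single n 1 + e
        · subst h
          have : Finsupp.single n 1 + e - Finsupp.single n 1 = e := by
            ext i; simp
          rw [this, if_pos rfl, if_pos rfl]
          simp only [Finsupp.add_apply, Finsupp.single_eq_same]
          push_cast
          ring
        · rw [if_neg h]
          by_cases h0 : d n = 0
          · simp [h0]
          · rw [if_neg]
            · simp
            · rintro rfl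
              apply h
              ext i
              by_cases hi : i = n
              · subst hi; simp; omega
              · simp [Finsupp.single_apply, Ne.symm hi]
      | add p p' hp hp' => simp only [map_add, coeff_add, hp, hp']; ring
    rw [hc]; ring
  | add p p' hp hp' => rw [mul_add, inner_add_right, inner_add_right, hp, hp']; ring

/-- the translation `p_n ↦ p_n + c_n`. -/
def TT (c : ℕ → F) : Sym F →ₐ[F] Sym F := aeval fun n => X n + C (c n)

lemma pderiv_TT (c : ℕ → F) (n : ℕ) (f : Sym F) : pderiv n (TT c f) = TT c (pderiv n f) := by
  classical
  induction f using MvPolynomial.induction_on with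
  | C a => simp [TT]
  | add p p' hp hp' => simp only [map_add, hp, hp']
  | mul_X p i hp =>
    rw [map_mul, Derivation.leibniz, Derivation.leibniz, hp]
    simp only [smul_eq_mul, map_add, map_mul, TT, aeval_X, pderiv_X, pderiv_C, add_zero]
    congr 1
    by_cases h : n = i
    · subst h; simp
    · simp [Pi.single_apply, h, Ne.symm h]

lemma TT_TT (c c' : ℕ → F) (h : ∀ n, c n + c' n = 0) (f : Sym F) : TT c' (TT c f) = f := by
  induction f using MvPolynomial.induction_on with
  | C a => simp [TT]
  | add p p' hp hp' => simp only [map_add, hp, hp']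
  | mul_X p i hp =>
    rw [map_mul, map_mul, hp]
    have : TT c' (TT c (X i)) = X i := by
      simp only [TT, aeval_X, map_add, algHom_C, algebraMap_eq]
      rw [add_assoc, ← C_add, add_comm (c' i), h]; simp
    rw [this]

lemma inner_one (q t : F) (f : Sym F) : innerQT q t f 1 = f.coeff 0 := by
  have := inner_monomial q t f 0 1
  rw [show (monomial 0 (1:F) : Sym F) = 1 from rfl] at this
  rw [this]; simp [zz]

lemma coeff_TT (c : ℕ → F) (f : Sym F) : (TT c f).coeff 0 = eval c f := by
  rw [← constantCoeff_eq]
  induction f using MvPolynomial.induction_on with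
  | C a => simp [TT]
  | add p p' hp hp' => simp only [map_add, hp, hp']
  | mul_X p i hp => simp only [map_mul, hp]; simp [TT]

lemma exists_adj (q t : F) (c : ℕ → F) (g : Sym F) : ∀ f : Sym F, ∃ s : Sym F,
    (∀ h, innerQT q t s h = innerQT q t f (g * h)) ∧ eval c s = innerQT q t (TT c f) g := by
  induction g using MvPolynomial.induction_on with
  | C a =>
    intro f
    refine ⟨a • f, fun h => ?_, ?_⟩
    · rw [inner_smul_left, ← smul_eq_C_mul, inner_smul_right]
    · have : (C a : Sym F) = a • 1 := by rw [smul_eq_C_mul, mul_one]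
      rw [this, inner_smul_right, inner_one, coeff_TT]
      simp [smul_eq_C_mul]
  | add p p' hp hp' =>
    intro f
    obtain ⟨s, h1, h2⟩ := hp f
    obtain ⟨s', h1', h2'⟩ := hp' f
    refine ⟨s + s', fun h => ?_, ?_⟩
    · rw [inner_add_left, add_mul, inner_add_right, h1, h1']
    · rw [map_add, inner_add_right, h2, h2']
  | mul_X p n hp =>
    intro f
    obtain ⟨s, h1, h2⟩ := hp (ww q t n • pderiv n f)
    refine ⟨s, fun h => ?_, ?_⟩
    · rw [h1, mul_comm p (X n), mul_assoc, inner_X_mul, inner_smul_left]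
    · rw [h2, mul_comm p, inner_X_mul, pderiv_TT, map_smul, inner_smul_left]

section nondeg

variable [CharZero F]

lemma zz_ne (q t : F) (hq : ∀ n : ℕ, q ^ (n + 1) ≠ 1) (ht : ∀ n : ℕ, t ^ (n + 1) ≠ 1)
    (d : ℕ →₀ ℕ) : zz q t d ≠ 0 := by
  unfold zz
  rw [Finsupp.prod]
  refine Finset.prod_ne_zero_iff.mpr fun n _ => ?_
  have h1 : (1 - q ^ (n + 1)) ≠ 0 := sub_ne_zero.mpr (hq n).symm
  have h2 : (1 - t ^ (n + 1)) ≠ 0 := sub_ne_zero.mpr (ht n).symm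
  have h3 : (n : F) + 1 ≠ 0 := by exact_mod_cast n.succ_ne_zero
  have h4 : (Nat.factorial (d n) : F) ≠ 0 := by exact_mod_cast Nat.factorial_ne_zero _
  exact mul_ne_zero (mul_ne_zero (pow_ne_zero _ h3) h4) (pow_ne_zero _ (div_ne_zero h1 h2))

lemma nondeg (q t : F) (hq : ∀ n : ℕ, q ^ (n + 1) ≠ 1) (ht : ∀ n : ℕ, t ^ (n + 1) ≠ 1)
    (S : Set (Sym F)) (hS : Submodule.span F S = ⊤) (f : Sym F)
    (hf : ∀ g ∈ S, innerQT q t f g = 0) : f = 0 := by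
  have h : ∀ g, innerQT q t f g = 0 := by
    intro g
    have hle : Submodule.span F S ≤ LinearMap.ker (ipR q t f) := by
      rw [Submodule.span_le]
      intro x hx
      exact hf x hx
    rw [hS] at hle
    exact hle (Submodule.mem_top (x := g))
  ext d
  have := h (monomial d 1)
  rw [inner_monomial] at this
  simpa [zz_ne q t hq ht d] using this

/-- The main argument, from spanning. -/
lemma main_of_span (q t : F) (hq : ∀ n : ℕ, q ^ (n + 1) ≠ 1) (ht : ∀ n : ℕ, t ^ (n + 1) ≠ 1)
    (P : Partition → Sym F) (hP : ∀ lam mu, lam ≠ mu → innerQT q t (P lam) (P mu) = 0)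
    (hne : ∀ lam, P lam ≠ 0) (hspan : Submodule.span F (Set.range P) = ⊤)
    (c c' : ℕ → F) (hc : ∀ n, c n + c' n = 0) [DecidableEq Partition] (lam mu : Partition) :
    (∑ᶠ nu : Partition, eval c (skewQ q t P lam nu) * eval c' (skewQ q t P nu mu)) =
      if lam = mu then 1 else 0 := by
  classical
  have hn : ∀ lam, innerQT q t (P lam) (P lam) ≠ 0 := by
    intro lam h0
    apply hne lam
    apply nondeg q t hq ht _ hspan
    rintro _ ⟨mu, rfl⟩
    by_cases h : lam = mu
    · subst h; exact h0
    · exact hP _ _ h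
  have hQP : ∀ lam mu, innerQT q t (macQ q t P lam) (P mu) = if lam = mu then 1 else 0 := by
    intro lam mu
    unfold macQ bnorm
    rw [inner_smul_left]
    split_ifs with h
    · subst h; exact inv_mul_cancel₀ (hn _)
    · rw [hP _ _ h, mul_zero]
  -- expansion
  have hexp : ∀ f : Sym F, ∃ S : Finset Partition,
      (∀ nu, nu ∉ S → innerQT q t f (P nu) = 0) ∧
      f = ∑ nu ∈ S, innerQT q t f (P nu) • macQ q t P nu := by
    intro f
    have hf : f ∈ Submodule.span F (Set.range P) := by rw [hspan]; trivial
    obtain ⟨l, rfl⟩ := (Finsupp.mem_span_range_iff_exists_finsupp).mp hf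
    have key : ∀ nu, innerQT q t (l.sum fun i a => a • P i) (P nu)
        = l nu * innerQT q t (P nu) (P nu) := by
      intro nu
      rw [← ipL_apply, Finsupp.sum, map_sum]
      simp only [map_smul, ipL_apply, smul_eq_mul]
      rw [Finset.sum_eq_single nu]
      · intro b _ hb; rw [hP _ _ hb, mul_zero]
      · intro h; rw [Finsupp.notMem_support_iff.mp h, zero_mul]
    refine ⟨l.support, fun nu h => ?_, ?_⟩
    · rw [key, Finsupp.notMem_support_iff.mp h, zero_mul]
    · conv_lhs => rw [Finsupp.sum]
      refine Finset.sum_congr rfl fun nu _ => ?_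
      rw [key]
      unfold macQ bnorm
      rw [smul_smul, mul_assoc, mul_inv_cancel₀ (hn _), mul_one]
  -- skew evaluation
  have hskew : ∀ (c : ℕ → F) lam mu,
      eval c (skewQ q t P lam mu) = innerQT q t (TT c (macQ q t P lam)) (P mu) := by
    intro c lam mu
    obtain ⟨s, h1, h2⟩ := exists_adj q t c (P mu) (macQ q t P lam)
    rw [← h2]
    congr 1
    obtain ⟨S, hS, hs⟩ := hexp s
    unfold skewQ
    simp only [← h1]
    rw [finsum_eq_sum_of_support_subset (s := S)]
    · exact hs.symm
    · intro nu hnu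
      by_contra hn'
      exact hnu (by simp only [hS nu hn', zero_smul])
  simp only [hskew]
  obtain ⟨S, hS, hs⟩ := hexp (TT c (macQ q t P lam))
  rw [finsum_eq_sum_of_support_subset (s := S)]
  · have h3 := TT_TT c c' hc (macQ q t P lam)
    rw [hs, map_sum] at h3
    rw [← hQP]
    conv_rhs => rw [← h3]
    rw [← ipL_apply q t _ (P mu), map_sum]
    refine Finset.sum_congr rfl fun nu _ => ?_
    rw [map_smul, map_smul]; rfl
  · intro nu hnu
    by_contra hn'
    exact hnu (by simp only [hS nu hn', zero_mul])

/-! partitions -/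

lemma part_ext {k l : Partition} (h : ∀ j, k.part j = l.part j) : k = l := by
  cases k; cases l; congr; ext j; exact h j

lemma sum_le_size (k : Partition) (S : Finset ℕ) : ∑ j ∈ S, k.part j ≤ k.size := by
  unfold Partition.size
  rw [Finsupp.sum]
  exact Finset.sum_le_sum_of_ne_zero fun x _ h => Finsupp.mem_support_iff.mpr h

lemma part_le_size (k : Partition) (j : ℕ) : k.part j ≤ k.size := by
  simpa using sum_le_size k {j}

lemma part_eq_zero (k : Partition) (j : ℕ) (h : k.size ≤ j) : k.part j = 0 := by
  by_contra h0
  have h1 := sum_le_size k (Finset.range (j + 1))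
  have h2 : ∑ _i ∈ Finset.range (j + 1), 1 ≤ ∑ i ∈ Finset.range (j + 1), k.part i := by
    refine Finset.sum_le_sum fun i hi => ?_
    have := k.antitone' (Nat.lt_succ_iff.mp (Finset.mem_range.mp hi))
    omega
  simp at h2
  omega

lemma finite_le (r : ℕ) : {k : Partition | k.size ≤ r}.Finite := by
  let φ : Partition → (Fin r → Fin (r + 1)) := fun k j =>
    ⟨min (k.part j) r, by omega⟩
  refine Set.Finite.of_finite_image (f := φ) (Set.toFinite _) ?_
  intro k hk l hl hkl
  simp only [Set.mem_setOf_eq] at hk hl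
  apply part_ext
  intro j
  by_cases hj : j < r
  · have := congrFun hkl ⟨j, hj⟩
    simp only [φ, Fin.mk.injEq] at this
    have h1 := part_le_size k j
    have h2 := part_le_size l j
    omega
  · rw [part_eq_zero k j (by omega), part_eq_zero l j (by omega)]

lemma finite_eq (r : ℕ) : {k : Partition | k.size = r}.Finite :=
  (finite_le r).subset fun _ h => le_of_eq h

lemma hsym_eq (r : ℕ) :
    hsym F r = ∑ k ∈ (finite_eq r).toFinset, ((k.zee : F))⁻¹ • (pprod k : Sym F) := by
  unfold hsym
  exact finsum_mem_eq_finite_toFinset_sum _ (finite_eq r)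

lemma pprod_hom (k : Partition) :
    IsWeightedHomogeneous (fun n => n + 1) (pprod k : Sym F) k.size := by
  unfold pprod Partition.size
  rw [Finsupp.sum]
  apply IsWeightedHomogeneous.prod
  intro j hj
  have h : k.part j = (fun n => n + 1) (k.part j - 1) := by
    have := Finsupp.mem_support_iff.mp hj
    simp only; omega
  conv_rhs => rw [h]
  exact isWeightedHomogeneous_X _ _ _

lemma hsym_hom (r : ℕ) : IsWeightedHomogeneous (fun n => n + 1) (hsym F r) r := by
  rw [hsym_eq, ← mem_weightedHomogeneousSubmodule]
  refine Submodule.sum_mem _ fun k hk => Submodule.smul_mem _ _ ?_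
  have hk : k.size = r := by simpa using hk
  rw [mem_weightedHomogeneousSubmodule, ← hk]
  exact pprod_hom k

lemma hprod_hom (k : Partition) :
    IsWeightedHomogeneous (fun n => n + 1) (hprod F k) k.size := by
  unfold hprod Partition.size
  rw [Finsupp.sum]
  exact IsWeightedHomogeneous.prod _ _ _ fun j _ => hsym_hom _

lemma eq_single (k : Partition) (n j : ℕ) (hk : k.size = n) (hj : n ≤ k.part j) :
    k = Partition.single n := by
  have h0 : k.part j ≤ k.part 0 := k.antitone' (Nat.zero_le j)
  have h1 := part_le_size k 0
  apply part_ext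
  intro i
  by_cases hi : i = 0
  · subst hi; simp [Partition.single]; omega
  · have := sum_le_size k {0, i}
    rw [Finset.sum_pair (Ne.symm hi)] at this
    simp [Partition.single, Finsupp.single_apply, Ne.symm hi]; omega

lemma zee_ne (k : Partition) : (k.zee : F) ≠ 0 := by
  unfold Partition.zee
  rw [Nat.cast_ne_zero]
  refine Finset.prod_ne_zero_iff.mpr fun r hr => ?_
  have := (Finset.mem_Icc.mp hr).1
  exact mul_ne_zero (pow_ne_zero _ (by omega)) (Nat.factorial_ne_zero _)

lemma size_single (n : ℕ) : (Partition.single n).size = n := by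
  simp [Partition.size, Partition.single]

lemma pprod_single (n : ℕ) : (pprod (Partition.single (n + 1)) : Sym F) = X n := by
  unfold pprod Partition.single
  simp only
  rw [Finsupp.support_single_ne_zero _ (by omega)]
  simp

lemma X_mem (n : ℕ) : (X n : Sym F) ∈ Algebra.adjoin F (Set.range fun r => hsym F (r + 1)) := by
  classical
  induction n using Nat.strong_induction_on with
  | _ n ih =>
    set A := Algebra.adjoin F (Set.range fun r => hsym F (r + 1)) with hA
    have hh : hsym F (n + 1) ∈ A := Algebra.subset_adjoin ⟨n, rfl⟩
    rw [hsym_eq, ← Finset.add_sum_erase _ _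
      (show Partition.single (n + 1) ∈ (finite_eq (n + 1)).toFinset by simp [size_single]),
      pprod_single] at hh
    have h2 : ∑ k ∈ (finite_eq (n + 1)).toFinset.erase (Partition.single (n + 1)),
        ((k.zee : F))⁻¹ • (pprod k : Sym F) ∈ A := by
      refine A.sum_mem fun k hk => A.smul_mem ?_ _
      rw [Finset.mem_erase] at hk
      have hks : k.size = n + 1 := by simpa using hk.2
      unfold pprod
      refine A.prod_mem fun j hj => ih _ ?_
      have := Finsupp.mem_support_iff.mp hj
      by_contra hlt
      exact hk.1 (eq_single k (n + 1) j hks (by omega))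
    have h3 := A.sub_mem hh h2
    rw [add_sub_cancel_right] at h3
    have h4 := A.smul_mem h3 ((Partition.single (n + 1)).zee : F)
    rwa [smul_smul, mul_inv_cancel₀ (zee_ne _), one_smul] at h4

lemma adjoin_h : Algebra.adjoin F (Set.range fun r => hsym F (r + 1)) = ⊤ := by
  rw [eq_top_iff, ← MvPolynomial.adjoin_range_X]
  apply Algebra.adjoin_le
  rintro _ ⟨n, rfl⟩
  exact X_mem n

lemma exists_partition (s : Multiset ℕ) (hs : ∀ i ∈ s, 0 < i) (f : ℕ → Sym F) :
    ∃ k : Partition, ∏ j ∈ k.part.support, f (k.part j) = (s.map f).prod := by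
  classical
  set l := s.sort (· ≥ ·) with hl
  have hls : (l : Multiset ℕ) = s := Multiset.sort_eq s (· ≥ ·)
  have hsorted : l.Pairwise (· ≥ ·) := Multiset.pairwise_sort s (· ≥ ·)
  have hpos : ∀ (j : ℕ) (h : j < l.length), 0 < l[j] := by
    intro j h
    apply hs
    rw [← hls]
    exact List.getElem_mem h
  have happ : ∀ j, l.toFinsupp j = l.getD j 0 := fun j => rfl
  refine ⟨⟨l.toFinsupp, ?_⟩, ?_⟩
  · intro i j hij
    rw [happ, happ]
    by_cases hj : j < l.length
    · rw [List.getD_eq_getElem _ _ hj, List.getD_eq_getElem _ _ (lt_of_le_of_lt hij hj)]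
      rcases hij.lt_or_eq with h | h
      · exact List.pairwise_iff_getElem.mp hsorted i j _ hj h
      · subst h; rfl
    · rw [List.getD_eq_default _ _ (not_lt.mp hj)]; exact Nat.zero_le _
  · have hsup : l.toFinsupp.support = Finset.range l.length := by
      ext j
      rw [Finsupp.mem_support_iff, Finset.mem_range, happ]
      by_cases hj : j < l.length
      · rw [List.getD_eq_getElem _ _ hj]
        simp only [hj, iff_true]
        exact (hpos j hj).ne'
      · rw [List.getD_eq_default _ _ (not_lt.mp hj)]; simp [hj]
    simp only [hsup, happ]
    rw [← hls, Multiset.map_coe, Multiset.prod_coe, Finset.prod_range,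
      ← List.prod_ofFn]
    congr 1
    apply List.ext_getElem
    · simp
    · intro i h1 h2
      simp at h1
      simp [h1]

lemma span_h : Submodule.span F (Set.range (hprod F)) = ⊤ := by
  rw [eq_top_iff, ← Algebra.top_toSubmodule, ← adjoin_h, Algebra.adjoin_eq_span]
  apply Submodule.span_mono
  intro x hx
  have : ∃ s : Multiset ℕ, (∀ i ∈ s, 0 < i) ∧ (s.map (hsym F)).prod = x := by
    induction hx using Submonoid.closure_induction with
    | mem x hx =>
      obtain ⟨r, rfl⟩ := hx
      exact ⟨{r + 1}, by simp, by simp⟩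
    | one => exact ⟨0, by simp, by simp⟩
    | mul x y _ _ hx hy =>
      obtain ⟨s, hs, rfl⟩ := hx
      obtain ⟨s', hs', rfl⟩ := hy
      refine ⟨s + s', fun i hi => ?_, by simp⟩
      rcases Multiset.mem_add.mp hi with h | h
      · exact hs i h
      · exact hs' i h
  obtain ⟨s, hs, rfl⟩ := this
  obtain ⟨k, hk⟩ := exists_partition s hs (hsym F)
  exact ⟨k, hk⟩

lemma dom_antisymm {k l : Partition} (h : k.Dominates l) (h' : l.Dominates k) : k = l := by
  have hp : ∀ j, k.psum j = l.psum j := fun j => le_antisymm (h'.2 j) (h.2 j)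
  apply part_ext
  intro j
  have h1 := hp (j + 1)
  have h0 := hp j
  unfold Partition.psum at h0 h1
  rw [Finset.sum_range_succ, Finset.sum_range_succ] at h1
  omega

lemma dom_trans {k l m : Partition} (h : k.Dominates l) (h' : l.Dominates m) : k.Dominates m :=
  ⟨h'.1.trans h.1, fun j => (h'.2 j).trans (h.2 j)⟩

lemma dom_finite (k : Partition) : {l : Partition | k.Dominates l}.Finite :=
  (finite_eq k.size).subset fun _ h => h.1

lemma exists_dual (q t : F) (P : Partition → Sym F) (hP : IsMacdonald q t P)
    [DecidableEq Partition] :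
    ∀ (N : ℕ) (lam : Partition), {l : Partition | lam.Dominates l}.ncard ≤ N →
    ∃ m ∈ Submodule.span F (Set.range P),
      ∀ mu, innerQT t t m (hprod F mu) = if lam = mu then 1 else 0 := by
  intro N
  induction N with
  | zero =>
    intro lam h
    exfalso
    have := (Set.ncard_eq_zero (dom_finite lam)).mp (Nat.le_zero.mp h)
    have h2 : lam ∈ {l : Partition | lam.Dominates l} := ⟨rfl, fun _ => le_rfl⟩
    rw [this] at h2
    exact h2
  | succ N ih =>
    intro lam h
    have hex : ∀ mu : Partition, ∃ m : Sym F, (lam.Dominates mu → mu ≠ lam →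
        m ∈ Submodule.span F (Set.range P) ∧
        ∀ nu, innerQT t t m (hprod F nu) = if mu = nu then 1 else 0) := by
      intro mu
      by_cases hd : lam.Dominates mu ∧ mu ≠ lam
      · have hlt : {l : Partition | mu.Dominates l}.ncard
            < {l : Partition | lam.Dominates l}.ncard := by
          apply Set.ncard_lt_ncard _ (dom_finite lam)
          refine ⟨fun l hl => dom_trans hd.1 hl, fun hss => ?_⟩
          have : mu.Dominates lam := hss ⟨rfl, fun _ => le_rfl⟩
          exact hd.2 (dom_antisymm this hd.1)
        obtain ⟨m, h1, h2⟩ := ih mu (by omega)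
        exact ⟨m, fun _ _ => ⟨h1, h2⟩⟩
      · exact ⟨0, fun h1 h2 => absurd ⟨h1, h2⟩ hd⟩
    choose m hm using hex
    have hmem : ∀ mu ∈ (dom_finite lam).toFinset.erase lam,
        lam.Dominates mu ∧ mu ≠ lam := by
      intro mu hmu
      rw [Finset.mem_erase] at hmu
      exact ⟨by simpa using hmu.2, hmu.1⟩
    refine ⟨P lam - ∑ mu ∈ (dom_finite lam).toFinset.erase lam,
      innerQT t t (P lam) (hprod F mu) • m mu, ?_, ?_⟩
    · refine Submodule.sub_mem _ (Submodule.subset_span ⟨lam, rfl⟩)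
        (Submodule.sum_mem _ fun mu hmu => Submodule.smul_mem _ _ ?_)
      exact (hm mu (hmem mu hmu).1 (hmem mu hmu).2).1
    · intro nu
      rw [← ipL_apply, map_sub, map_sum]
      simp only [map_smul, ipL_apply, smul_eq_mul]
      have : ∑ mu ∈ (dom_finite lam).toFinset.erase lam,
          innerQT t t (P lam) (hprod F mu) * innerQT t t (m mu) (hprod F nu)
          = ∑ mu ∈ (dom_finite lam).toFinset.erase lam,
          innerQT t t (P lam) (hprod F mu) * if mu = nu then 1 else 0 := by
        refine Finset.sum_congr rfl fun mu hmu => ?_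
        rw [(hm mu (hmem mu hmu).1 (hmem mu hmu).2).2]
      rw [this]
      simp only [mul_ite, mul_one, mul_zero, Finset.sum_ite_eq']
      by_cases hl : lam = nu
      · subst hl
        simp [hP.2.1]
      · by_cases hd : lam.Dominates nu
        · have : nu ∈ (dom_finite lam).toFinset.erase lam := by
            rw [Finset.mem_erase]; exact ⟨Ne.symm hl, by simpa using hd⟩
          rw [if_pos this, if_neg hl, sub_self]
        · rw [hP.2.2 _ _ hd, if_neg hl]; simp

lemma span_P (q t : F) (ht : ∀ n : ℕ, t ^ (n + 1) ≠ 1) (P : Partition → Sym F)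
    (hP : IsMacdonald q t P) : Submodule.span F (Set.range P) = ⊤ := by
  classical
  have hex : ∀ lam, ∃ m ∈ Submodule.span F (Set.range P),
      ∀ mu, innerQT t t m (hprod F mu) = if lam = mu then 1 else 0 :=
    fun lam => exists_dual q t P hP _ lam le_rfl
  choose m hm1 hm2 using hex
  rw [eq_top_iff]
  intro f _
  set N := f.support.sup (Finsupp.weight fun n => n + 1) with hN
  have hz : ∀ mu : Partition, ¬ mu.size ≤ N → innerQT t t f (hprod F mu) = 0 := by
    intro mu hmu
    rw [inner_eq t t f _ _ subset_rfl]
    refine Finset.sum_eq_zero fun d hd => ?_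
    by_cases hc : coeff d (hprod F mu) = 0
    · rw [hc]; ring
    · exfalso
      apply hmu
      rw [← hprod_hom mu hc]
      exact Finset.le_sup (f := Finsupp.weight fun n => n + 1) hd
  have hfe : f - ∑ mu ∈ (finite_le N).toFinset, innerQT t t f (hprod F mu) • m mu = 0 := by
    apply nondeg t t ht ht _ span_h
    rintro _ ⟨nu, rfl⟩
    rw [← ipL_apply, map_sub, map_sum]
    simp only [map_smul, ipL_apply, smul_eq_mul, hm2, mul_ite, mul_one, mul_zero,
      Finset.sum_ite_eq']
    by_cases h : nu.size ≤ N
    · simp [h]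
    · simp [h, hz nu h]
  rw [sub_eq_zero.mp hfe]
  exact Submodule.sum_mem _ fun mu _ => Submodule.smul_mem _ _ (hm1 mu)

end nondeg

lemma X_pow_ne {K : Type*} [Field K] (n : ℕ) : (RatFunc.X : RatFunc K) ^ (n + 1) ≠ 1 := by
  intro h
  rw [← RatFunc.algebraMap_X, ← map_pow, ← map_one (algebraMap (Polynomial K) (RatFunc K))] at h
  have h2 := RatFunc.algebraMap_injective K h
  have := congrArg Polynomial.natDegree h2
  simp at this

lemma C_pow_ne {K : Type*} [Field K] (x : K) (n : ℕ) (h : x ^ (n + 1) ≠ 1) :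
    (RatFunc.C x) ^ (n + 1) ≠ 1 := by
  intro h'
  rw [← map_pow, ← map_one RatFunc.C] at h'
  exact h (RatFunc.C.injective h')

end Aux

open Classical in
/-- Orthogonality of plethystically evaluated skew Macdonald
`Q`-functions: for all partitions `λ, μ` and parameters `a, b`,
`∑_ν Q_{λ/ν}((a-b)/(1-t)) Q_{ν/μ}((b-a)/(1-t)) = δ_{λμ}`. -/
theorem orthogonality_skew_macdonald_Q
    (P : Partition → Sym F4) (hP : IsMacdonald q4 t4 P) (lam mu : Partition) :
    (∑ᶠ nu : Partition,
        plethAB t4 a4 b4 (skewQ q4 t4 P lam nu) * plethAB t4 b4 a4 (skewQ q4 t4 P nu mu)) =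
      if lam = mu then 1 else 0 := by
  have hq : ∀ n : ℕ, q4 ^ (n + 1) ≠ 1 := fun n =>
    Aux.C_pow_ne _ n (Aux.C_pow_ne _ n (Aux.X_pow_ne n))
  have ht : ∀ n : ℕ, t4 ^ (n + 1) ≠ 1 := fun n =>
    Aux.C_pow_ne _ n (Aux.C_pow_ne _ n (Aux.C_pow_ne _ n (Aux.X_pow_ne n)))
  haveI : CharZero F4 := inferInstance
  refine Aux.main_of_span q4 t4 hq ht P hP.1 ?_ (Aux.span_P q4 t4 ht P hP) _ _ ?_ lam mu
  · intro k hk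
    have := hP.2.1 k
    rw [hk] at this
    simp [innerQT] at this
  · intro n
    ring

end SkewPieriFormalization
end
end
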